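/- arXiv:2205.06738 — 3 statements merged into one kernel-verified Lean document; each statement's English description precedes it below -/
import Mathlib

section
/- Let m, n be positive integers and let A be a real m×n matrix of rank r = αn for some 0 < α < 1. Suppose A is (k,D)-ℓ₂-ARIP for some k ≥ 1 and D ≥ 1, and fix η > 0 such that 64·D⁸/(1−α)⁴ ≤ n^η ≤ k/D². Then there exists a submatrix T ∈ ℝ^{t×n} consisting of t ≤ m rows of A such that: (1) ‖T‖_F² / ‖A‖_F² ≥ n^{−η}; (2) t ≥ k/(D²·n^η); and (3) every row x of T satisfies Δ_{1,2}(x) ≤ c·(D³n/(η·√(1−α)·log n))^{1/2} for a universal constant c > 0. -/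
open Finset

/-- The ℓ_p norm of a vector `x`, `‖x‖_p = (∑ i, |x i|^p)^(1/p)`. -/
noncomputable def pNorm (p : ℝ) {ι : Type*} [Fintype ι] (x : ι → ℝ) : ℝ :=
  (∑ i, |x i| ^ p) ^ (1 / p)

/-- The (ℓ_q, ℓ_p)-distortion of a vector `x ∈ ℝⁿ`:
`Δ_{q,p}(x) = ‖x‖_p · n^(1/q - 1/p) / ‖x‖_q`. -/
noncomputable def distortion (q p : ℝ) {ι : Type*} [Fintype ι] (x : ι → ℝ) : ℝ :=
  pNorm p x * (Fintype.card ι : ℝ) ^ (1 / q - 1 / p) / pNorm q x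

/-- A vector is `k`-sparse if it has at most `k` nonzero entries. -/
def IsSparse (k : ℝ) {ι : Type*} [Fintype ι] (x : ι → ℝ) : Prop :=
  ((Finset.univ.filter (fun i => x i ≠ 0)).card : ℝ) ≤ k

/-- A matrix `A` is `(k, D)`-ℓ_p-RIP if there is `K > 0` with
`K‖x‖_p ≤ ‖Ax‖_p ≤ D·K‖x‖_p` for every `k`-sparse `x`. -/
def IsRIP (p : ℝ) {ι κ : Type*} [Fintype ι] [Fintype κ] (A : Matrix ι κ ℝ) (k D : ℝ) : Prop :=
  ∃ K > 0, ∀ x : κ → ℝ, IsSparse k x →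
    K * pNorm p x ≤ pNorm p (A.mulVec x) ∧ pNorm p (A.mulVec x) ≤ D * K * pNorm p x

/-- A matrix `A ∈ ℝ^{m×n}` is `(k, D)`-ℓ₂-ARIP if there is `K > 0` with
`K‖x‖₂ ≤ ‖Ax‖₂ ≤ D·K‖x‖₂` for every `x` with `Δ_{1,2}(x) ≥ (n/k)^(1/2)`. -/
def IsARIP {ι κ : Type*} [Fintype ι] [Fintype κ] (A : Matrix ι κ ℝ) (k D : ℝ) : Prop :=
  ∃ K > 0, ∀ x : κ → ℝ, ((Fintype.card κ : ℝ) / k) ^ ((1 : ℝ) / 2) ≤ distortion 1 2 x →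
    K * pNorm 2 x ≤ pNorm 2 (A.mulVec x) ∧ pNorm 2 (A.mulVec x) ≤ D * K * pNorm 2 x

/-- The Frobenius norm of a matrix. -/
noncomputable def frobNorm {ι κ : Type*} [Fintype ι] [Fintype κ] (A : Matrix ι κ ℝ) : ℝ :=
  Real.sqrt (∑ i, ∑ j, (A i j) ^ 2)

theorem mul_sinc (x : ℝ) : x * Real.sinc x = Real.sin x := by
  by_cases hx : x = 0
  · simp [hx]
  · rw [Real.sinc_of_ne_zero hx]; field_simp

theorem sinc_sq_le_one (x : ℝ) : Real.sinc x ^ 2 ≤ 1 :=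
  (sq_le_one_iff_abs_le_one _).mpr (Real.abs_sinc_le_one x)

theorem hasSum_sinc (r : ℝ) :
    HasSum (fun n : ℕ => (-1 : ℝ) ^ n / ((2 * n + 1).factorial : ℝ) * (r ^ 2) ^ n)
      (Real.sinc r) := by
  by_cases hr : r = 0
  · subst hr
    rw [Real.sinc_zero]
    convert hasSum_single (0 : ℕ) ?_ using 1
    · simp
    · intro n hn
      simp [hn]
  · rw [Real.sinc_of_ne_zero hr]
    refine Eq.subst (motive := fun f => HasSum f (Real.sin r / r)) (funext fun n => ?_)
      ((Real.hasSum_sin r).div_const r)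
    rw [pow_succ, ← pow_mul]
    field_simp

/-- Decay of powers of the cardinal sine at infinity. -/
theorem one_add_sq_mul_sinc_sq_le (x : ℝ) : (1 + x ^ 2) * Real.sinc x ^ 2 ≤ 2 := by
  have h1 := sinc_sq_le_one x
  have h2 : (x * Real.sinc x) ^ 2 ≤ 1 := by
    rw [mul_sinc]; exact Real.sin_sq_le_one x
  nlinarith

theorem sq_mul_sinc_pow_le (x : ℝ) :
    x ^ 2 * Real.sinc x ^ 12 ≤ 64 * ((1 + x ^ 2) ^ 5)⁻¹ := by
  have hp : 0 < 1 + x ^ 2 := by positivity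
  have h : ((1 + x ^ 2) * Real.sinc x ^ 2) ^ 6 ≤ 2 ^ 6 :=
    pow_le_pow_left₀ (by positivity) (one_add_sq_mul_sinc_sq_le x) 6
  rw [← div_eq_mul_inv, le_div_iff₀ (by positivity)]
  have h3 : 0 ≤ Real.sinc x ^ 12 * (1 + x ^ 2) ^ 5 := by positivity
  nlinarith

theorem three_quarters_le_sinc {x : ℝ} (h0 : 0 ≤ x) (h1 : x ≤ 1) : 3 / 4 ≤ Real.sinc x := by
  rcases h0.eq_or_lt with rfl | h
  · simp; norm_num
  · rw [Real.sinc_of_ne_zero h.ne', le_div_iff₀ h]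
    have := Real.sin_gt_sub_cube h
    nlinarith [mul_nonneg h.le (by nlinarith : 0 ≤ 1 - x ^ 2)]

/-- The two-scale lower bound for powers of the cardinal sine. -/
theorem le_sinc_pow {x : ℝ} (h0 : 0 ≤ x) :
    ((1 + x ^ 2) ^ 5)⁻¹ - ((1 + (x / 2) ^ 2) ^ 5)⁻¹ / 8 ≤ 32 * Real.sinc x ^ 12 := by
  rcases le_total x 1 with h1 | h1
  · have h2 : ((1 + x ^ 2) ^ 5)⁻¹ ≤ 1 :=
      inv_le_one_of_one_le₀ (one_le_pow₀ (by nlinarith))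
    have h3 : 0 ≤ ((1 + (x / 2) ^ 2) ^ 5)⁻¹ / 8 := by positivity
    have h4 : (3 / 4 : ℝ) ^ 12 ≤ Real.sinc x ^ 12 :=
      pow_le_pow_left₀ (by norm_num) (three_quarters_le_sinc h0 h1) 12
    norm_num at h4
    linarith
  · have h2 : ((1 + x ^ 2) ^ 5)⁻¹ ≤ ((1 + (x / 2) ^ 2) ^ 5)⁻¹ / 8 := by
      rw [← one_div, ← one_div, div_div, one_div_le_one_div (by positivity) (by positivity)]
      have h5 : (8 / 5 * (1 + (x / 2) ^ 2)) ^ 5 ≤ (1 + x ^ 2) ^ 5 :=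
        pow_le_pow_left₀ (by positivity) (by nlinarith) 5
      have h6 : 0 ≤ (1 + (x / 2) ^ 2) ^ 5 := by positivity
      nlinarith
    have h3 : 0 ≤ Real.sinc x ^ 12 := by positivity
    linarith

/-- A finite set of nonnegative numbers whose counting function satisfies a quadratic inequality
at all scales `T ≤ T₀` has at most `262144 / (κ T₀ ^ 2)` zeros. -/
theorem card_zero_le_of_sinc_sum {ι : Type*} [Fintype ι] (lam : ι → ℝ) (hlam : ∀ l, 0 ≤ lam l)
    {κ T₀ : ℝ} (hT₀ : 0 < T₀)
    (h : ∀ T, 0 < T → T ≤ T₀ → κ * (∑ l, Real.sinc (T * √(lam l)) ^ 12) ^ 2 ≤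
      ∑ l, lam l * Real.sinc (T * √(lam l)) ^ 12) (hκ : 0 < κ) :
    κ * T₀ ^ 2 * (#{l | lam l = 0} : ℝ) ≤ 262144 := by
  set R : ℝ → ℝ := fun T => ∑ l, ((1 + (T * √(lam l)) ^ 2) ^ 5)⁻¹ with hR
  have hR0 : ∀ T, 0 ≤ R T := fun T => Finset.sum_nonneg fun l _ => by positivity
  have hRcard : ∀ T, R T ≤ Fintype.card ι := fun T => by
    calc R T ≤ ∑ _l : ι, (1 : ℝ) := Finset.sum_le_sum fun l _ =>
          inv_le_one_of_one_le₀ (one_le_pow₀ (by nlinarith [sq_nonneg (T * √(lam l))]))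
      _ = _ := by simp
  have hzero : (#{l | lam l = 0} : ℝ) ≤ R T₀ := by
    calc (#{l | lam l = 0} : ℝ) = ∑ l with lam l = 0, ((1 + (T₀ * √(lam l)) ^ 2) ^ 5)⁻¹ := by
          rw [Finset.card_eq_sum_ones, Nat.cast_sum]
          refine Finset.sum_congr rfl fun l hl => ?_
          simp [(Finset.mem_filter.mp hl).2]
      _ ≤ R T₀ := Finset.sum_le_sum_of_subset_of_nonneg (Finset.subset_univ _)
          fun l _ _ => by positivity
  have key : ∀ T, 0 < T → T ≤ T₀ → R (T / 2) ≤ 4 * R T → κ * T ^ 2 * R T ≤ 262144 := by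
    intro T hT hTT h4
    have hup : T ^ 2 * ∑ l, lam l * Real.sinc (T * √(lam l)) ^ 12 ≤ 64 * R T := by
      rw [Finset.mul_sum, hR, Finset.mul_sum]
      refine Finset.sum_le_sum fun l _ => ?_
      have := sq_mul_sinc_pow_le (T * √(lam l))
      rw [mul_pow, Real.sq_sqrt (hlam l)] at this ⊢
      rwa [mul_assoc] at this
    have hlow : R T - R (T / 2) / 8 ≤ 32 * ∑ l, Real.sinc (T * √(lam l)) ^ 12 := by
      rw [hR, Finset.mul_sum, Finset.sum_div, ← Finset.sum_sub_distrib]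
      refine Finset.sum_le_sum fun l _ => ?_
      have := le_sinc_pow (x := T * √(lam l)) (by positivity)
      rwa [mul_div_right_comm] at this
    have hF : R T / 64 ≤ ∑ l, Real.sinc (T * √(lam l)) ^ 12 := by linarith
    have hF2 : (R T / 64) ^ 2 ≤ (∑ l, Real.sinc (T * √(lam l)) ^ 12) ^ 2 :=
      pow_le_pow_left₀ (by have := hR0 T; positivity) hF 2
    have h5 : T ^ 2 * (κ * (R T / 64) ^ 2) ≤ 64 * R T :=
      (mul_le_mul_of_nonneg_left ((mul_le_mul_of_nonneg_left hF2 hκ.le).trans (h T hT hTT))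
        (sq_nonneg T)).trans hup
    rcases (hR0 T).eq_or_lt with h0 | h0
    · rw [← h0]; norm_num
    · refine le_of_mul_le_mul_right ?_ h0
      linarith
  by_contra! hcon
  have hbig : 262144 < κ * T₀ ^ 2 * R T₀ := hcon.trans_le (by gcongr)
  have hscale : ∀ i : ℕ, 262144 < κ * (T₀ / 2 ^ i) ^ 2 * R (T₀ / 2 ^ i) ∧
      4 ^ i * R T₀ ≤ R (T₀ / 2 ^ i) := by
    intro i
    induction i with
    | zero => simpa using hbig
    | succ i ih =>
      obtain ⟨h1, h2⟩ := ih
      have hlt : 4 * R (T₀ / 2 ^ i) < R (T₀ / 2 ^ i / 2) := by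
        by_contra! h4
        exact absurd (key _ (by positivity) (div_le_self hT₀.le (one_le_pow₀ (by norm_num))) h4)
          (not_le.mpr h1)
      have he : T₀ / 2 ^ (i + 1) = T₀ / 2 ^ i / 2 := by rw [pow_succ, div_div]
      rw [he]
      constructor
      · have : κ * (T₀ / 2 ^ i / 2) ^ 2 * (4 * R (T₀ / 2 ^ i)) ≤
            κ * (T₀ / 2 ^ i / 2) ^ 2 * R (T₀ / 2 ^ i / 2) :=
          mul_le_mul_of_nonneg_left hlt.le (by positivity)
        linarith
      · rw [pow_succ]; linarith
  have hpos : 0 < R T₀ := pos_of_mul_pos_right (by linarith) (by positivity : 0 ≤ κ * T₀ ^ 2)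
  obtain ⟨i, hi⟩ := pow_unbounded_of_one_lt (Fintype.card ι / R T₀) (by norm_num : (1 : ℝ) < 4)
  rw [div_lt_iff₀ hpos] at hi
  linarith [(hscale i).2, hRcard (T₀ / 2 ^ i)]

section WeightedColSum

variable {ι : Type*} [Fintype ι]

/-- The `ℓ₁` operator norm of `X` with respect to the weights `d` is at most `e`. -/
def WeightedColSumLE (d : ι → ℝ) (X : Matrix ι ι ℝ) (e : ℝ) : Prop :=
  ∀ j, ∑ i, |X i j| * d i ≤ e * d j

namespace WeightedColSumLE

variable {d : ι → ℝ} {X Y : Matrix ι ι ℝ} {e f : ℝ}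

theorem one [DecidableEq ι] (d : ι → ℝ) : WeightedColSumLE d 1 1 := by
  intro j
  simp [Matrix.one_apply, apply_ite abs]

theorem mul (hd : ∀ i, 0 ≤ d i) (he : 0 ≤ e) (hX : WeightedColSumLE d X e)
    (hY : WeightedColSumLE d Y f) : WeightedColSumLE d (X * Y) (e * f) := by
  intro j
  calc ∑ i, |(X * Y) i j| * d i ≤ ∑ i, ∑ l, |X i l| * |Y l j| * d i := by
        refine Finset.sum_le_sum fun i _ => ?_
        rw [Matrix.mul_apply, ← Finset.sum_mul]
        refine mul_le_mul_of_nonneg_right ((Finset.abs_sum_le_sum_abs _ _).trans_eq ?_) (hd i)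
        simp [abs_mul]
    _ = ∑ l, |Y l j| * ∑ i, |X i l| * d i := by
        rw [Finset.sum_comm]
        refine Finset.sum_congr rfl fun l _ => ?_
        rw [Finset.mul_sum]
        exact Finset.sum_congr rfl fun i _ => by ring
    _ ≤ ∑ l, |Y l j| * (e * d l) :=
        Finset.sum_le_sum fun l _ => mul_le_mul_of_nonneg_left (hX l) (abs_nonneg _)
    _ = e * ∑ l, |Y l j| * d l := by
        rw [Finset.mul_sum]
        exact Finset.sum_congr rfl fun i _ => by ring
    _ ≤ e * (f * d j) := mul_le_mul_of_nonneg_left (hY j) he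
    _ = e * f * d j := by ring

theorem pow [DecidableEq ι] (hd : ∀ i, 0 ≤ d i) (he : 0 ≤ e) (hX : WeightedColSumLE d X e)
    (m : ℕ) : WeightedColSumLE d (X ^ m) (e ^ m) := by
  induction m with
  | zero => simpa using one d
  | succ m ih => rw [pow_succ, pow_succ]; exact mul hd (pow_nonneg he m) ih hX

end WeightedColSumLE

end WeightedColSum

section Spectral

variable {ι κ : Type*} [Fintype ι] [DecidableEq ι] [Fintype κ]

theorem exists_diagonalization (C : Matrix κ ι ℝ) :
    ∃ (lam : ι → ℝ) (U : Matrix ι ι ℝ), (∀ l, 0 ≤ lam l) ∧ U * U.transpose = 1 ∧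
      U.transpose * U = 1 ∧
      C.transpose * C = U * Matrix.diagonal lam * U.transpose ∧
      Fintype.card ι = C.rank + #{l | lam l = 0} := by
  have hps : (C.transpose * C).PosSemidef := by
    simpa using Matrix.posSemidef_conjTranspose_mul_self C
  have hH := hps.isHermitian
  refine ⟨hH.eigenvalues, (hH.eigenvectorUnitary : Matrix ι ι ℝ), hps.eigenvalues_nonneg,
    ?_, ?_, ?_, ?_⟩
  · simpa [Matrix.star_eq_conjTranspose] using Unitary.mul_star_self_of_mem hH.eigenvectorUnitary.2
  · simpa [Matrix.star_eq_conjTranspose] using Unitary.star_mul_self_of_mem hH.eigenvectorUnitary.2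
  · have := hH.spectral_theorem
    rw [Unitary.conjStarAlgAut_apply] at this
    simpa [Matrix.star_eq_conjTranspose] using this
  · rw [← Matrix.rank_transpose_mul_self, hH.rank_eq_card_non_zero_eigs, Fintype.card_subtype,
      add_comm, Finset.card_filter_add_card_filter_not, Finset.card_univ]

theorem spectral_apply (U : Matrix ι ι ℝ) (f : ι → ℝ) (i j : ι) :
    (U * Matrix.diagonal f * U.transpose) i j = ∑ l, f l * (U i l * U j l) := by
  rw [Matrix.mul_apply]
  refine Finset.sum_congr rfl fun l _ => ?_
  rw [Matrix.mul_diagonal, Matrix.transpose_apply]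
  ring

theorem spectral_mul {U : Matrix ι ι ℝ} (hU : U.transpose * U = 1) (f g : ι → ℝ) :
    (U * Matrix.diagonal f * U.transpose) * (U * Matrix.diagonal g * U.transpose) =
      U * Matrix.diagonal (fun l => f l * g l) * U.transpose := by
  rw [← Matrix.diagonal_mul_diagonal]
  calc _ = U * Matrix.diagonal f * (U.transpose * U) * Matrix.diagonal g * U.transpose := by
        simp only [Matrix.mul_assoc]
    _ = _ := by rw [hU]; simp only [Matrix.mul_assoc, Matrix.one_mul]

theorem spectral_pow {U : Matrix ι ι ℝ} (hU : U.transpose * U = 1) (hU' : U * U.transpose = 1)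
    (f : ι → ℝ) (m : ℕ) :
    (U * Matrix.diagonal f * U.transpose) ^ m =
      U * Matrix.diagonal (fun l => f l ^ m) * U.transpose := by
  induction m with
  | zero => simp [hU']
  | succ m ih => rw [pow_succ, ih, spectral_mul hU]; simp only [pow_succ]

theorem spectral_trace {U : Matrix ι ι ℝ} (hU : U.transpose * U = 1) (f : ι → ℝ) :
    (U * Matrix.diagonal f * U.transpose).trace = ∑ l, f l := by
  rw [Matrix.trace_mul_comm, ← Matrix.mul_assoc, hU, Matrix.one_mul, Matrix.trace_diagonal]

theorem sum_inv_factorial_mul_pow_le {x : ℝ} (hx : 0 ≤ x) (s : Finset ℕ) :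
    ∑ m ∈ s, (1 / ((2 * m + 1).factorial : ℝ)) * (x ^ 2) ^ m ≤ Real.exp x := by
  calc _ ≤ ∑ m ∈ s, x ^ (2 * m) / ((2 * m).factorial : ℝ) := by
        refine Finset.sum_le_sum fun m _ => ?_
        rw [← pow_mul, one_div_mul_eq_div]
        gcongr
        omega
    _ ≤ Real.cosh x := sum_le_hasSum _ (fun m _ => by positivity) (Real.hasSum_cosh x)
    _ ≤ Real.exp x := by
        rw [Real.cosh_eq]
        have : Real.exp (-x) ≤ Real.exp x := Real.exp_le_exp.mpr (by linarith)
        linarith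

/-- Finite speed of propagation: the wave operator `sinc (T √B)` grows at most exponentially in
`T √τ` on the weighted `ℓ₁` space, where `τ` bounds the norm of `B` there. -/
theorem weightedColSumLE_sinc {U : Matrix ι ι ℝ} (hU : U.transpose * U = 1)
    (hU' : U * U.transpose = 1) {lam : ι → ℝ} (hlam : ∀ l, 0 ≤ lam l) {d : ι → ℝ}
    (hd : ∀ i, 0 ≤ d i) {τ T : ℝ} (hτ : 0 ≤ τ) (hT : 0 ≤ T)
    (hB : WeightedColSumLE d (U * Matrix.diagonal lam * U.transpose) τ) :
    WeightedColSumLE d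
      (U * Matrix.diagonal (fun l => Real.sinc (T * √(lam l))) * U.transpose)
      (Real.exp (T * √τ)) := by
  intro j
  set B := U * Matrix.diagonal lam * U.transpose with hBdef
  set c : ℕ → ℝ := fun m => (-1 : ℝ) ^ m / ((2 * m + 1).factorial : ℝ) * (T ^ 2) ^ m with hc
  have hsum : ∀ i, HasSum (fun m => c m * (B ^ m) i j)
      ((U * Matrix.diagonal (fun l => Real.sinc (T * √(lam l))) * U.transpose) i j) := by
    intro i
    rw [spectral_apply]
    have : (fun m => c m * (B ^ m) i j) =
        fun m => ∑ l, (-1 : ℝ) ^ m / ((2 * m + 1).factorial : ℝ) * ((T * √(lam l)) ^ 2) ^ m *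
          (U i l * U j l) := by
      funext m
      rw [hBdef, spectral_pow hU hU', spectral_apply, Finset.mul_sum]
      refine Finset.sum_congr rfl fun l _ => ?_
      rw [mul_pow T, Real.sq_sqrt (hlam l), mul_pow]
      ring
    rw [this]
    exact hasSum_sum fun l _ => (hasSum_sinc _).mul_right _
  refine le_of_tendsto
    (tendsto_finsetSum _ fun i _ => (Filter.Tendsto.abs (hsum i)).mul_const (d i))
    (Filter.Eventually.of_forall fun s => ?_)
  calc ∑ i, |∑ m ∈ s, c m * (B ^ m) i j| * d i
      ≤ ∑ i, ∑ m ∈ s, |c m| * (|(B ^ m) i j| * d i) := by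
        refine Finset.sum_le_sum fun i _ => ?_
        simp only [← mul_assoc, ← abs_mul]
        rw [← Finset.sum_mul]
        exact mul_le_mul_of_nonneg_right (Finset.abs_sum_le_sum_abs _ _) (hd i)
    _ = ∑ m ∈ s, |c m| * ∑ i, |(B ^ m) i j| * d i := by
        rw [Finset.sum_comm]
        simp only [Finset.mul_sum]
    _ ≤ ∑ m ∈ s, |c m| * (τ ^ m * d j) :=
        Finset.sum_le_sum fun m _ =>
          mul_le_mul_of_nonneg_left (hB.pow hd hτ m j) (abs_nonneg _)
    _ = (∑ m ∈ s, (1 / ((2 * m + 1).factorial : ℝ)) * ((T * √τ) ^ 2) ^ m) * d j := by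
        rw [Finset.sum_mul]
        refine Finset.sum_congr rfl fun m _ => ?_
        rw [hc, mul_pow, Real.sq_sqrt hτ, mul_pow]
        simp only [abs_mul, abs_div, abs_pow, abs_neg, abs_one, one_pow, Nat.abs_cast, sq_abs]
        ring
    _ ≤ _ := mul_le_mul_of_nonneg_right
        (sum_inv_factorial_mul_pow_le (mul_nonneg hT (Real.sqrt_nonneg _)) s) (hd j)

end Spectral

section TestVectors

variable {ι κ : Type*} [Fintype ι]

theorem sq_sum_mul_le (a z : ι → ℝ) : (∑ i, a i * z i) ^ 2 ≤ (∑ i, a i ^ 2 * |z i|) * ∑ i, |z i| :=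
  Finset.sum_sq_le_sum_mul_sum_of_sq_le_mul _ (fun i _ => by positivity) (fun i _ => abs_nonneg _)
    fun i _ => by rw [mul_pow, ← sq_abs (z i)]; exact le_of_eq (by ring)

/-- Action on vectors with small `ℓ₁` norm of a set of rows whose columns are small. -/
theorem sum_sq_mulVec_le (A : Matrix κ ι ℝ) (G : Finset κ) {w z : ι → ℝ} {γ Z : ℝ}
    (hw : ∀ i, 0 ≤ w i) (hw1 : ∀ i, w i ≤ 1) (hγ : ∀ i, w i * ∑ a ∈ G, A a i ^ 2 ≤ γ)
    (hγ0 : 0 ≤ γ) (hZ : ∑ i, |z i| ≤ Z) :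
    ∑ a ∈ G, (A.mulVec (fun i => w i * z i) a) ^ 2 ≤ γ * Z ^ 2 := by
  have hz0 : 0 ≤ ∑ i, |z i| := Finset.sum_nonneg fun i _ => abs_nonneg _
  calc ∑ a ∈ G, (A.mulVec (fun i => w i * z i) a) ^ 2
      ≤ ∑ a ∈ G, (∑ i, (A a i * w i) ^ 2 * |z i|) * ∑ i, |z i| := by
        refine Finset.sum_le_sum fun a _ => ?_
        have := sq_sum_mul_le (fun i => A a i * w i) z
        simpa only [Matrix.mulVec, dotProduct, mul_assoc] using this
    _ = (∑ i, (w i * (w i * ∑ a ∈ G, A a i ^ 2)) * |z i|) * ∑ i, |z i| := by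
        rw [← Finset.sum_mul, Finset.sum_comm]
        congr 1
        refine Finset.sum_congr rfl fun i _ => ?_
        rw [← Finset.sum_mul, Finset.mul_sum, Finset.mul_sum]
        congr 1
        exact Finset.sum_congr rfl fun a _ => by ring
    _ ≤ (∑ i, γ * |z i|) * ∑ i, |z i| := by
        refine mul_le_mul_of_nonneg_right (Finset.sum_le_sum fun i _ =>
          mul_le_mul_of_nonneg_right ?_ (abs_nonneg _)) hz0
        calc w i * (w i * ∑ a ∈ G, A a i ^ 2) ≤ w i * γ := mul_le_mul_of_nonneg_left (hγ i) (hw i)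
          _ ≤ γ := mul_le_of_le_one_left hγ0 (hw1 i)
    _ = γ * (∑ i, |z i|) ^ 2 := by rw [← Finset.mul_sum]; ring
    _ ≤ γ * Z ^ 2 := by gcongr

variable [Fintype κ]

/-- The lower bound for compressible vectors, extended to all vectors with an error term. -/
theorem lower_bound_add_error {A : Matrix κ ι ℝ} {k L : ℝ} (hk : 0 < k) (hL : 0 ≤ L)
    (hA : ∀ x : ι → ℝ, (∑ i, |x i|) ^ 2 ≤ k * ∑ i, x i ^ 2 →
      L * ∑ i, x i ^ 2 ≤ ∑ a, (A.mulVec x a) ^ 2)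
    {x : ι → ℝ} {Z : ℝ} (hZ : ∑ i, |x i| ≤ Z) :
    L * ∑ i, x i ^ 2 ≤ ∑ a, (A.mulVec x a) ^ 2 + L / k * Z ^ 2 := by
  by_cases h : (∑ i, |x i|) ^ 2 ≤ k * ∑ i, x i ^ 2
  · have := hA x h
    have : 0 ≤ L / k * Z ^ 2 := by positivity
    linarith
  · have h1 : (∑ i, |x i|) ^ 2 ≤ Z ^ 2 :=
      pow_le_pow_left₀ (Finset.sum_nonneg fun i _ => abs_nonneg _) hZ 2
    have h2 : 0 ≤ ∑ a, (A.mulVec x a) ^ 2 := Finset.sum_nonneg fun a _ => sq_nonneg _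
    have h3 : L / k * (k * ∑ i, x i ^ 2) ≤ L / k * Z ^ 2 :=
      mul_le_mul_of_nonneg_left ((not_le.mp h).le.trans h1) (by positivity)
    have h4 : L / k * (k * ∑ i, x i ^ 2) = L * ∑ i, x i ^ 2 := by field_simp
    linarith

variable [DecidableEq ι] [DecidableEq κ]

/-- The quadratic inequality for the spectrum of the Gram matrix of the reweighted rows outside
`G`. -/
theorem exists_spectrum_sinc_inequality (A : Matrix κ ι ℝ) (G : Finset κ) {k L M γ N : ℝ}
    (hk : 0 < k) (hL : 0 ≤ L) (hM : 0 ≤ M) (hγ0 : 0 ≤ γ)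
    (hA : ∀ x : ι → ℝ, (∑ i, |x i|) ^ 2 ≤ k * ∑ i, x i ^ 2 →
      L * ∑ i, x i ^ 2 ≤ ∑ a, (A.mulVec x a) ^ 2)
    {w : ι → ℝ} (hw : ∀ i, 0 < w i) (hw1 : ∀ i, w i ≤ 1)
    (hMw : ∀ i, w i * ∑ a ∈ Gᶜ, |A a i| * ∑ j, |A a j| ≤ M)
    (hγ : ∀ i, w i * ∑ a ∈ G, A a i ^ 2 ≤ γ) (hN : ∑ i, (w i)⁻¹ ≤ N) :
    ∃ lam : ι → ℝ, (∀ l, 0 ≤ lam l) ∧ Fintype.card ι ≤ A.rank + #{l | lam l = 0} ∧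
      ∀ T, 0 ≤ T → L * (∑ l, Real.sinc (T * √(lam l)) ^ 12) ^ 2 ≤
        N * (∑ l, lam l * Real.sinc (T * √(lam l)) ^ 12 +
          (L / k + γ) * N * (Real.exp (T * √M) ^ 6) ^ 2) := by
  set C : Matrix κ ι ℝ := Matrix.diagonal (fun a => if a ∈ G then (0 : ℝ) else 1) * A *
    Matrix.diagonal (fun i => √(w i)) with hC
  obtain ⟨lam, U, hlam, hU', hU, hspec, hcard⟩ := exists_diagonalization C
  have hCapp : ∀ a i, C a i = (if a ∈ G then 0 else 1) * A a i * √(w i) := fun a i => by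
    rw [hC, Matrix.mul_diagonal, Matrix.diagonal_mul]
  refine ⟨lam, hlam, ?_, fun T hT => ?_⟩
  · rw [hcard]
    gcongr
    exact (Matrix.rank_mul_le_left _ _).trans (Matrix.rank_mul_le_right _ _)
  set d : ι → ℝ := fun i => (√(w i))⁻¹ with hd
  have hsq : ∀ i, 0 < √(w i) := fun i => Real.sqrt_pos.mpr (hw i)
  have hd0 : ∀ i, 0 ≤ d i := fun i => (inv_pos.mpr (hsq i)).le
  have hd2 : ∀ i, d i ^ 2 = (w i)⁻¹ := fun i => by
    rw [hd, inv_pow, Real.sq_sqrt (hw i).le]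
  set E : ℝ := Real.exp (T * √M) ^ 6 with hE
  set q : ι → ℝ := fun l => Real.sinc (T * √(lam l)) with hq
  set Q : Matrix ι ι ℝ := U * Matrix.diagonal (fun l => q l ^ 6) * U.transpose with hQ
  have hB : WeightedColSumLE d (U * Matrix.diagonal lam * U.transpose) M := by
    rw [← hspec]
    intro j
    calc ∑ i, |(C.transpose * C) i j| * d i
        ≤ ∑ i, ∑ a ∈ Gᶜ, |A a i| * (|A a j| * √(w j)) := by
          refine Finset.sum_le_sum fun i _ => ?_
          have : (C.transpose * C) i j = ∑ a ∈ Gᶜ, A a i * √(w i) * (A a j * √(w j)) := by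
            rw [Matrix.mul_apply, ← Finset.sum_add_sum_compl G, Finset.sum_eq_zero, zero_add]
            · refine Finset.sum_congr rfl fun a ha => ?_
              rw [Matrix.transpose_apply, hCapp, hCapp, if_neg (Finset.mem_compl.mp ha)]
              ring
            · intro a ha
              rw [Matrix.transpose_apply, hCapp, if_pos ha]
              ring
          rw [this]
          calc _ ≤ (∑ a ∈ Gᶜ, |A a i * √(w i) * (A a j * √(w j))|) * d i :=
                mul_le_mul_of_nonneg_right (Finset.abs_sum_le_sum_abs _ _) (hd0 i)
            _ = _ := by
                rw [Finset.sum_mul]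
                refine Finset.sum_congr rfl fun a _ => ?_
                have := (hsq i).ne'
                simp only [hd, abs_mul, abs_of_pos (hsq _)]
                field_simp
      _ = √(w j) * ∑ a ∈ Gᶜ, |A a j| * ∑ i, |A a i| := by
          rw [Finset.sum_comm, Finset.mul_sum]
          refine Finset.sum_congr rfl fun a _ => ?_
          rw [← Finset.sum_mul]
          ring
      _ ≤ M * d j := by
          rw [hd, ← div_eq_mul_inv, le_div_iff₀ (hsq j), mul_right_comm,
            Real.mul_self_sqrt (hw j).le]
          exact hMw j
  have hQE : WeightedColSumLE d Q E := by
    have := (weightedColSumLE_sinc hU hU' hlam hd0 hM hT hB).pow hd0 (Real.exp_pos _).le 6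
    rwa [spectral_pow hU hU'] at this
  have hQsym : ∀ i j, Q i j = Q j i := fun i j => by
    rw [hQ, spectral_apply, spectral_apply]
    exact Finset.sum_congr rfl fun l _ => by ring
  have hQQ : Q * Q = U * Matrix.diagonal (fun l => q l ^ 12) * U.transpose := by
    rw [hQ, spectral_mul hU]
    simp only [← pow_add]
  set h : ι → ℝ := fun i => ∑ j, Q i j ^ 2 with hh
  have hdiag : ∀ i, h i = (Q * Q) i i := fun i => by
    rw [Matrix.mul_apply]
    exact Finset.sum_congr rfl fun j _ => by rw [hQsym j i]; ring
  have hh0 : ∀ i, 0 ≤ h i := fun i => Finset.sum_nonneg fun j _ => sq_nonneg _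
  have hh1 : ∀ i, h i ≤ 1 := fun i => by
    rw [hdiag, hQQ, spectral_apply]
    calc _ ≤ ∑ l, U i l * U i l := Finset.sum_le_sum fun l _ =>
          mul_le_of_le_one_left (mul_self_nonneg _) (by
            have := pow_le_one₀ (sq_nonneg _) (sinc_sq_le_one (T * √(lam l))) (n := 6)
            rwa [← pow_mul] at this)
      _ = (U * U.transpose) i i := by simp [Matrix.mul_apply]
      _ = 1 := by rw [hU', Matrix.one_apply_eq]
  have hhsum : ∑ i, h i = ∑ l, q l ^ 12 := by
    rw [← spectral_trace hU (fun l => q l ^ 12), ← hQQ]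
    exact Finset.sum_congr rfl fun i _ => hdiag i
  have hN0 : 0 ≤ N := (Finset.sum_nonneg fun i _ => (inv_pos.mpr (hw i)).le).trans hN
  have hCS : (∑ l, q l ^ 12) ^ 2 ≤ N * ∑ i, w i * h i := by
    rw [← hhsum]
    calc (∑ i, h i) ^ 2 ≤ (∑ i, h i / w i) * ∑ i, w i * h i :=
          Finset.sum_sq_le_sum_mul_sum_of_sq_le_mul _
            (fun i _ => div_nonneg (hh0 i) (hw i).le)
            (fun i _ => mul_nonneg (hw i).le (hh0 i))
            fun i _ => le_of_eq (by have := (hw i).ne'; field_simp)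
      _ ≤ N * ∑ i, w i * h i := by
          refine mul_le_mul_of_nonneg_right (le_trans ?_ hN)
            (Finset.sum_nonneg fun i _ => mul_nonneg (hw i).le (hh0 i))
          refine Finset.sum_le_sum fun i _ => ?_
          rw [← one_div]
          exact div_le_div_of_nonneg_right (hh1 i) (hw i).le
  have htest : ∀ j, L * ∑ i, w i * Q i j ^ 2 ≤
      ∑ a, ((C * Q) a j) ^ 2 + (L / k + γ) * (E ^ 2 * (w j)⁻¹) := by
    intro j
    have hz : ∑ i, |Q i j * d i| ≤ E * d j := by
      simpa only [abs_mul, abs_of_nonneg (hd0 _)] using hQE j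
    have hwd : ∀ i, w i * (Q i j * d i) = √(w i) * Q i j := fun i => by
      have h1 := Real.mul_self_sqrt (hw i).le
      have h2 := (hsq i).ne'
      calc w i * (Q i j * d i) = (√(w i) * √(w i)) * (Q i j * (√(w i))⁻¹) := by rw [h1]
        _ = _ := by field_simp
    have hx : ∑ i, |w i * (Q i j * d i)| ≤ E * d j := by
      refine le_trans (Finset.sum_le_sum fun i _ => ?_) hz
      rw [abs_mul, abs_of_pos (hw i)]
      exact mul_le_of_le_one_left (abs_nonneg _) (hw1 i)
    have h1 := lower_bound_add_error hk hL hA hx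
    have h2 := sum_sq_mulVec_le A G (fun i => (hw i).le) hw1 hγ hγ0 hz
    have h3 : ∑ a ∈ Gᶜ, (A.mulVec (fun i => w i * (Q i j * d i)) a) ^ 2 ≤
        ∑ a, ((C * Q) a j) ^ 2 := by
      refine le_trans (Finset.sum_le_sum fun a ha => le_of_eq ?_)
        (Finset.sum_le_sum_of_subset_of_nonneg (Finset.subset_univ Gᶜ) fun _ _ _ => sq_nonneg _)
      congr 1
      rw [Matrix.mul_apply]
      simp only [Matrix.mulVec, dotProduct]
      refine Finset.sum_congr rfl fun i _ => ?_
      rw [hwd, hCapp, if_neg (Finset.mem_compl.mp ha)]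
      ring
    have h4 : ∑ i, (w i * (Q i j * d i)) ^ 2 = ∑ i, w i * Q i j ^ 2 :=
      Finset.sum_congr rfl fun i _ => by rw [hwd, mul_pow, Real.sq_sqrt (hw i).le]
    rw [h4, ← Finset.sum_add_sum_compl G, mul_pow, hd2] at h1
    rw [mul_pow, hd2] at h2
    linarith
  have hsumtest := Finset.sum_le_sum fun j (_ : j ∈ Finset.univ) => htest j
  rw [← Finset.mul_sum, Finset.sum_add_distrib, ← Finset.mul_sum, ← Finset.mul_sum] at hsumtest
  have hleft : ∑ j, ∑ i, w i * Q i j ^ 2 = ∑ i, w i * h i := by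
    rw [Finset.sum_comm]
    simp only [hh, Finset.mul_sum]
  have hright : ∑ j, ∑ a, ((C * Q) a j) ^ 2 = ∑ l, lam l * q l ^ 12 := by
    have : ∑ j, ∑ a, ((C * Q) a j) ^ 2 = ((C * Q).transpose * (C * Q)).trace := by
      refine Finset.sum_congr rfl fun j _ => ?_
      rw [Matrix.diag_apply, Matrix.mul_apply]
      exact Finset.sum_congr rfl fun a _ => by rw [Matrix.transpose_apply]; ring
    have hQt : Q.transpose = Q := by ext i j; exact hQsym j i
    rw [this, Matrix.transpose_mul, hQt, Matrix.mul_assoc, Matrix.trace_mul_comm,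
      ← Matrix.mul_assoc C.transpose, Matrix.mul_assoc, hQQ, hspec, spectral_mul hU,
      spectral_trace hU]
  rw [hleft, hright] at hsumtest
  have herr : (L / k + γ) * (E ^ 2 * ∑ j, (w j)⁻¹) ≤ (L / k + γ) * N * E ^ 2 := by
    rw [mul_assoc, mul_comm N]
    gcongr
  calc L * (∑ l, q l ^ 12) ^ 2 ≤ L * (N * ∑ i, w i * h i) := by gcongr
    _ = N * (L * ∑ i, w i * h i) := by ring
    _ ≤ _ := by
        refine mul_le_mul_of_nonneg_left ?_ hN0
        linarith

end TestVectors

section Compressible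

variable {ι κ : Type*} [Fintype ι]

theorem pNorm_one_eq (x : ι → ℝ) : pNorm 1 x = ∑ i, |x i| := by
  simp [pNorm]

theorem pNorm_two_eq (x : ι → ℝ) : pNorm 2 x = √(∑ i, x i ^ 2) := by
  simp [pNorm, Real.sqrt_eq_rpow]

theorem distortion_one_two_eq (x : ι → ℝ) :
    distortion 1 2 x = √(∑ i, x i ^ 2) * √(Fintype.card ι) / ∑ i, |x i| := by
  rw [distortion, pNorm_one_eq, pNorm_two_eq, Real.sqrt_eq_rpow (Fintype.card ι : ℝ)]
  norm_num

theorem distortion_le_of_le_sq_sum {x : ι → ℝ} {s : ℝ} (hs : 0 < s)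
    (h : s * ∑ i, x i ^ 2 ≤ (∑ i, |x i|) ^ 2) :
    distortion 1 2 x ≤ √(Fintype.card ι / s) := by
  rw [distortion_one_two_eq]
  have h0 : 0 ≤ ∑ i, |x i| := Finset.sum_nonneg fun i _ => abs_nonneg _
  refine div_le_of_le_mul₀ h0 (Real.sqrt_nonneg _) ?_
  have h1 : √(∑ i, x i ^ 2) ≤ (∑ i, |x i|) / √s := by
    rw [le_div_iff₀ (Real.sqrt_pos.mpr hs), ← Real.sqrt_mul' _ hs.le, mul_comm]
    exact Real.sqrt_le_iff.mpr ⟨h0, h⟩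
  calc √(∑ i, x i ^ 2) * √(Fintype.card ι) ≤ (∑ i, |x i|) / √s * √(Fintype.card ι) := by gcongr
    _ = √(Fintype.card ι / s) * ∑ i, |x i| := by
        rw [Real.sqrt_div (Nat.cast_nonneg _)]; ring

theorem card_eq_rank_of_mulVec_injective [DecidableEq ι] {A : Matrix κ ι ℝ}
    (h : ∀ x, A.mulVec x = 0 → x = 0) : A.rank = Fintype.card ι := by
  have hinj : Function.Injective A.mulVecLin :=
    (injective_iff_map_eq_zero A.mulVecLin).mpr fun x hx => h x hx
  rw [Matrix.rank, LinearMap.finrank_range_of_inj hinj, Module.finrank_fintype_fun_eq_card]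

variable [Fintype κ]

theorem IsARIP.exists_sq_bounds {A : Matrix κ ι ℝ} {k D : ℝ} (hk : 0 < k)
    (hA : IsARIP A k D) :
    ∃ L > 0, ∀ x : ι → ℝ, (∑ i, |x i|) ^ 2 ≤ k * ∑ i, x i ^ 2 →
      L * ∑ i, x i ^ 2 ≤ ∑ a, (A.mulVec x a) ^ 2 ∧
        ∑ a, (A.mulVec x a) ^ 2 ≤ D ^ 2 * L * ∑ i, x i ^ 2 := by
  obtain ⟨K, hK, h⟩ := hA
  refine ⟨K ^ 2, by positivity, fun x hx => ?_⟩
  by_cases hx0 : x = 0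
  · simp [hx0]
  have hpos : 0 < ∑ i, |x i| := by
    obtain ⟨i, hi⟩ := Function.ne_iff.mp hx0
    exact Finset.sum_pos' (fun i _ => abs_nonneg _) ⟨i, Finset.mem_univ i, abs_pos.mpr hi⟩
  have hX0 : 0 ≤ ∑ i, x i ^ 2 := Finset.sum_nonneg fun i _ => sq_nonneg _
  have hY0 : 0 ≤ ∑ a, (A.mulVec x a) ^ 2 := Finset.sum_nonneg fun i _ => sq_nonneg _
  obtain ⟨h1, h2⟩ := h x (by
    rw [distortion_one_two_eq, ← Real.sqrt_eq_rpow, Real.sqrt_div (Nat.cast_nonneg _),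
      div_le_div_iff₀ (Real.sqrt_pos.mpr hk) hpos]
    have := Real.le_sqrt_of_sq_le hx
    rw [Real.sqrt_mul hk.le] at this
    nlinarith [Real.sqrt_nonneg (Fintype.card ι : ℝ)])
  rw [pNorm_two_eq, pNorm_two_eq] at h1 h2
  have h3 := pow_le_pow_left₀ (by positivity) h1 2
  have h4 := pow_le_pow_left₀ (by positivity) h2 2
  simp only [mul_pow, Real.sq_sqrt hX0, Real.sq_sqrt hY0] at h3 h4
  exact ⟨h3, h4⟩

theorem frobNorm_sq (A : Matrix κ ι ℝ) : frobNorm A ^ 2 = ∑ i, ∑ j, A i j ^ 2 :=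
  Real.sq_sqrt (Finset.sum_nonneg fun _ _ => Finset.sum_nonneg fun _ _ => sq_nonneg _)

theorem sum_sq_le_sq_sum_abs (x : ι → ℝ) : ∑ i, x i ^ 2 ≤ (∑ i, |x i|) ^ 2 := by
  simpa only [sq_abs] using
    Finset.sum_sq_le_sq_sum_of_nonneg (s := Finset.univ) (f := fun i => |x i|)
      fun i _ => abs_nonneg _

theorem sq_sum_abs_le_card_mul (x : ι → ℝ) (s : Finset ι) (hx : ∀ i ∉ s, x i = 0) :
    (∑ i, |x i|) ^ 2 ≤ #s * ∑ i, x i ^ 2 := by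
  have h1 : ∑ i, |x i| = ∑ i ∈ s, |x i| :=
    (Finset.sum_subset (Finset.subset_univ s) fun i _ hi => by simp [hx i hi]).symm
  have h2 : ∑ i ∈ s, x i ^ 2 ≤ ∑ i, x i ^ 2 :=
    Finset.sum_le_sum_of_subset_of_nonneg (Finset.subset_univ s) fun i _ _ => sq_nonneg _
  calc (∑ i, |x i|) ^ 2 ≤ #s * ∑ i ∈ s, |x i| ^ 2 := h1 ▸ sq_sum_le_card_mul_sum_sq
    _ ≤ _ := by simp only [sq_abs]; gcongr

theorem lt_card_of_rank_lt [DecidableEq ι] {A : Matrix κ ι ℝ} {k L : ℝ} (hL : 0 < L)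
    (hA : ∀ x : ι → ℝ, (∑ i, |x i|) ^ 2 ≤ k * ∑ i, x i ^ 2 →
      L * ∑ i, x i ^ 2 ≤ ∑ a, (A.mulVec x a) ^ 2)
    (hr : A.rank < Fintype.card ι) : k < Fintype.card ι := by
  by_contra! hk
  refine hr.ne (card_eq_rank_of_mulVec_injective fun x hx => ?_)
  have hX0 : 0 ≤ ∑ i, x i ^ 2 := Finset.sum_nonneg fun i _ => sq_nonneg _
  have h1 := hA x ((sq_sum_abs_le_card_mul x Finset.univ (by simp)).trans (by
    rw [Finset.card_univ]; gcongr))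
  simp only [hx, Pi.zero_apply, ne_eq, OfNat.ofNat_ne_zero, not_false_eq_true, zero_pow,
    Finset.sum_const_zero] at h1
  have h2 : ∑ i, x i ^ 2 = 0 := le_antisymm (nonpos_of_mul_nonpos_right h1 hL) hX0
  funext i
  simpa using (Finset.sum_eq_zero_iff_of_nonneg fun i _ => sq_nonneg _).mp h2 i
    (Finset.mem_univ i)

theorem sum_sq_restrict_row_le [DecidableEq ι] {A : Matrix κ ι ℝ} {k U : ℝ}
    (hA : ∀ x : ι → ℝ, (∑ i, |x i|) ^ 2 ≤ k * ∑ i, x i ^ 2 →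
      ∑ a, (A.mulVec x a) ^ 2 ≤ U * ∑ i, x i ^ 2) (hU : 0 ≤ U)
    (a : κ) (s : Finset ι) (hs : (#s : ℝ) ≤ k) : ∑ j ∈ s, A a j ^ 2 ≤ U := by
  set x : ι → ℝ := fun j => if j ∈ s then A a j else 0 with hx
  have hsum : ∑ j, x j ^ 2 = ∑ j ∈ s, A a j ^ 2 := by
    simp [hx, ite_pow, Finset.sum_ite_mem]
  have hX0 : 0 ≤ ∑ j ∈ s, A a j ^ 2 := Finset.sum_nonneg fun i _ => sq_nonneg _
  have hAx : A.mulVec x a = ∑ j ∈ s, A a j ^ 2 := by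
    simp [Matrix.mulVec, dotProduct, hx, mul_ite, Finset.sum_ite_mem, sq]
  have h1 := hA x ((sq_sum_abs_le_card_mul x s fun i hi => if_neg hi).trans (by gcongr))
  have h2 : (A.mulVec x a) ^ 2 ≤ ∑ b, (A.mulVec x b) ^ 2 :=
    Finset.single_le_sum (f := fun b => (A.mulVec x b) ^ 2) (fun b _ => sq_nonneg _)
      (Finset.mem_univ a)
  rw [hsum] at h1
  rw [hAx] at h2
  rcases hX0.eq_or_lt with h0 | h0
  · rwa [← h0]
  · exact le_of_mul_le_mul_right (by nlinarith) h0

/-- Averaging a sum over all cyclic shifts of an interval. -/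
theorem sum_le_of_forall_card_eq {n q : ℕ} (hq : q ≤ n) {g : Fin n → ℝ} {U : ℝ}
    (h : ∀ s : Finset (Fin n), #s = q → ∑ j ∈ s, g j ≤ U) : q * ∑ j, g j ≤ n * U := by
  rcases n.eq_zero_or_pos with rfl | hn
  · simp
  have : NeZero n := ⟨hn.ne'⟩
  set I : Finset (Fin n) := Finset.univ.filter fun j => j.val < q with hI
  have hcard : #I = q := by
    rw [hI, Fin.card_filter_val_lt, min_eq_right hq]
  calc q * ∑ j, g j = ∑ i ∈ I, ∑ r : Fin n, g (i + r) := by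
        rw [← hcard, ← nsmul_eq_mul, ← Finset.sum_const]
        exact Finset.sum_congr rfl fun i _ => (Equiv.sum_comp (Equiv.addLeft i) g).symm
    _ = ∑ r : Fin n, ∑ i ∈ I.map (Equiv.addRight r).toEmbedding, g i := by
        rw [Finset.sum_comm]
        simp only [Finset.sum_map, Equiv.coe_toEmbedding, Equiv.coe_addRight]
    _ ≤ ∑ _r : Fin n, U := Finset.sum_le_sum fun r _ => h _ (by rw [Finset.card_map, hcard])
    _ = n * U := by simp

theorem row_sum_sq_le {n : ℕ} {A : Matrix κ (Fin n) ℝ} {k U : ℝ} (hk : 1 ≤ k) (hkn : k ≤ n)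
    (hA : ∀ x : Fin n → ℝ, (∑ i, |x i|) ^ 2 ≤ k * ∑ i, x i ^ 2 →
      ∑ a, (A.mulVec x a) ^ 2 ≤ U * ∑ i, x i ^ 2) (hU : 0 ≤ U) (a : κ) :
    k * ∑ j, A a j ^ 2 ≤ 2 * (n * U) := by
  have hfl : (⌊k⌋₊ : ℝ) ≤ k := Nat.floor_le (by linarith)
  have h1 : (⌊k⌋₊ : ℝ) * ∑ j, A a j ^ 2 ≤ n * U := by
    refine sum_le_of_forall_card_eq (by exact_mod_cast hfl.trans hkn) fun s hs => ?_
    exact sum_sq_restrict_row_le hA hU a s (by rw [hs]; exact hfl)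
  have h2 : k ≤ 2 * ⌊k⌋₊ := by
    have h3 := Nat.lt_floor_add_one k
    have h4 : (1 : ℝ) ≤ ⌊k⌋₊ := by exact_mod_cast Nat.one_le_floor_iff k |>.mpr hk
    linarith
  have h0 : 0 ≤ ∑ j, A a j ^ 2 := Finset.sum_nonneg fun i _ => sq_nonneg _
  nlinarith

theorem col_sum_sq_bounds [DecidableEq ι] {A : Matrix κ ι ℝ} {k L U : ℝ} (hk : 1 ≤ k)
    (hA : ∀ x : ι → ℝ, (∑ i, |x i|) ^ 2 ≤ k * ∑ i, x i ^ 2 →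
      L * ∑ i, x i ^ 2 ≤ ∑ a, (A.mulVec x a) ^ 2 ∧
        ∑ a, (A.mulVec x a) ^ 2 ≤ U * ∑ i, x i ^ 2) (j : ι) :
    L ≤ ∑ a, A a j ^ 2 ∧ ∑ a, A a j ^ 2 ≤ U := by
  have h := hA (Pi.single j 1) (by simp [Pi.single_apply, apply_ite abs, ite_pow, hk])
  simpa [Pi.single_apply, ite_pow] using h

end Compressible

section Numerics

theorem error_le_of_pow_le {y D β : ℝ} (hy : 0 < y) (hD : 1 ≤ D) (hβ : 0 < β)
    (h : 64 * D ^ 8 / β ^ 4 ≤ y ^ 8) (h64 : 64 ≤ y ^ 8) :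
    36 * D ^ 2 * y ≤ β ^ 2 * y ^ 8 := by
  have h1 : 8 * D ^ 4 ≤ β ^ 2 * y ^ 4 := by
    rw [div_le_iff₀ (by positivity)] at h
    refine le_of_sq_le_sq ?_ (by positivity)
    nlinarith
  have h2 : 9 / 2 ≤ y ^ 3 := by
    refine le_of_pow_le_pow_left₀ (by norm_num : 8 ≠ 0) (by positivity) ?_
    have : (64 : ℝ) ^ 3 ≤ (y ^ 8) ^ 3 := pow_le_pow_left₀ (by norm_num) h64 3
    calc (9 / 2 : ℝ) ^ 8 ≤ 64 ^ 3 := by norm_num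
      _ ≤ (y ^ 8) ^ 3 := this
      _ = (y ^ 3) ^ 8 := by ring
  have h3 : D ^ 2 ≤ D ^ 4 := pow_le_pow_right₀ hD (by norm_num)
  calc 36 * D ^ 2 * y ≤ 36 * D ^ 4 * y := by gcongr
    _ = 8 * D ^ 4 * y * (9 / 2) := by ring
    _ ≤ 8 * D ^ 4 * y * y ^ 3 := by gcongr
    _ = 8 * D ^ 4 * y ^ 4 := by ring
    _ ≤ β ^ 2 * y ^ 4 * y ^ 4 := by gcongr
    _ = β ^ 2 * y ^ 8 := by ring

theorem le_mul_of_card_bound {N L Λ s D β : ℝ} (hN : 0 < N) (hL : 0 < L) (hs : 0 < s)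
    (hD : 1 ≤ D) {Z : ℝ} (hZ : β * N ≤ Z)
    (h : L / (12 * N) * (Λ / (96 * √(s * (D ^ 2 * L)))) ^ 2 * Z ≤ 262144) :
    Λ ^ 2 * β ≤ 28991029248 * s * D ^ 2 := by
  have h0 : 0 ≤ L / (12 * N) * (Λ / (96 * √(s * (D ^ 2 * L)))) ^ 2 := by positivity
  have h1 := (mul_le_mul_of_nonneg_left hZ h0).trans h
  rw [div_pow, mul_pow, Real.sq_sqrt (by positivity)] at h1
  have h2 : L / (12 * N) * (Λ ^ 2 / (96 ^ 2 * (s * (D ^ 2 * L)))) * (β * N) =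
      Λ ^ 2 * β / (110592 * (s * D ^ 2)) := by
    field_simp
    ring
  rw [h2, div_le_iff₀ (by positivity)] at h1
  linarith

end Numerics

/-- The rows with large `ℓ₁` norm relative to their `ℓ₂` norm carry a `P⁻¹` fraction of the
Frobenius norm. -/
theorem sum_sq_dense_rows_ge {ι κ : Type*} [Fintype ι] [Fintype κ] [DecidableEq ι]
    [DecidableEq κ] [Nonempty ι] {A : Matrix κ ι ℝ} {k D L P β : ℝ} (hk : 1 ≤ k) (hD : 1 ≤ D)
    (hL : 0 < L)
    (hA : ∀ x : ι → ℝ, (∑ i, |x i|) ^ 2 ≤ k * ∑ i, x i ^ 2 →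
      L * ∑ i, x i ^ 2 ≤ ∑ a, (A.mulVec x a) ^ 2 ∧
        ∑ a, (A.mulVec x a) ^ 2 ≤ D ^ 2 * L * ∑ i, x i ^ 2)
    (hβ : 0 < β) (hβ1 : β ≤ 1) (hrank : β * Fintype.card ι + A.rank ≤ Fintype.card ι)
    (hP : 64 * D ^ 8 / β ^ 4 ≤ P) (hPk : P ≤ k / D ^ 2) (G : Finset κ)
    (hG : ∀ a, a ∈ G ↔ √β * Real.log P / (10 ^ 6 * D ^ 3) * ∑ j, A a j ^ 2 ≤
      (∑ j, |A a j|) ^ 2) :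
    2 * P⁻¹ * ∑ a, ∑ j, A a j ^ 2 ≤ ∑ a ∈ G, ∑ j, A a j ^ 2 := by
  set s := √β * Real.log P / (10 ^ 6 * D ^ 3) with hs
  set F := ∑ a, ∑ j, A a j ^ 2 with hF
  set N : ℝ := (Fintype.card ι : ℝ) with hN
  have hN0 : 0 < N := by rw [hN]; exact_mod_cast Fintype.card_pos
  have hP64 : 64 ≤ P := by
    refine le_trans ?_ hP
    rw [le_div_iff₀ (by positivity)]
    have h1 : β ^ 4 ≤ 1 := pow_le_one₀ hβ.le hβ1
    have h2 : 1 ≤ D ^ 8 := one_le_pow₀ hD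
    linarith
  have hP0 : 0 < P := by linarith
  have hF0 : 0 ≤ F := Finset.sum_nonneg fun _ _ => Finset.sum_nonneg fun _ _ => sq_nonneg _
  have hcol := col_sum_sq_bounds hk hA
  have hFU : F ≤ N * (D ^ 2 * L) := by
    rw [hF, Finset.sum_comm]
    calc _ ≤ ∑ _j : ι, D ^ 2 * L := Finset.sum_le_sum fun j _ => (hcol j).2
      _ = _ := by simp [hN]
  by_contra! hcon
  have hPinv : P⁻¹ ≤ 1 / 64 := by rw [← one_div]; gcongr
  obtain ⟨a₀, ha₀⟩ : ∃ a, a ∉ G := by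
    by_contra! hall
    rw [Finset.eq_univ_iff_forall.mpr hall, ← hF] at hcon
    nlinarith
  have hs1 : 1 < s := by
    have h1 := not_le.mp ((hG a₀).not.mp ha₀)
    have h2 := sum_sq_le_sq_sum_abs (A a₀)
    have h3 : 0 ≤ ∑ j, A a₀ j ^ 2 := Finset.sum_nonneg fun _ _ => sq_nonneg _
    by_contra! h4
    nlinarith
  set γ := 2 * P⁻¹ * (D ^ 2 * L) with hγ
  set M := s * (D ^ 2 * L) with hM
  have hγ0 : 0 < γ := by positivity
  have hM0 : 0 < M := mul_pos (by linarith) (by positivity)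
  set b : ι → ℝ := fun i => ∑ a ∈ Gᶜ, |A a i| * ∑ j, |A a j| with hb
  set g : ι → ℝ := fun i => ∑ a ∈ G, A a i ^ 2 with hg
  have hb0 : ∀ i, 0 ≤ b i := fun i => Finset.sum_nonneg fun a _ =>
    mul_nonneg (abs_nonneg _) (Finset.sum_nonneg fun _ _ => abs_nonneg _)
  have hg0 : ∀ i, 0 ≤ g i := fun i => Finset.sum_nonneg fun _ _ => sq_nonneg _
  have hbsum : ∑ i, b i ≤ M * N := by
    calc ∑ i, b i = ∑ a ∈ Gᶜ, (∑ j, |A a j|) ^ 2 := by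
          rw [hb, Finset.sum_comm]
          exact Finset.sum_congr rfl fun a _ => by rw [← Finset.sum_mul, sq]
      _ ≤ ∑ a ∈ Gᶜ, s * ∑ j, A a j ^ 2 := Finset.sum_le_sum fun a ha =>
          (not_le.mp ((hG a).not.mp (Finset.mem_compl.mp ha))).le
      _ ≤ s * F := by
          rw [← Finset.mul_sum]
          refine mul_le_mul_of_nonneg_left ?_ (by linarith)
          exact Finset.sum_le_sum_of_subset_of_nonneg (Finset.subset_univ _)
            fun _ _ _ => Finset.sum_nonneg fun _ _ => sq_nonneg _
      _ ≤ s * (N * (D ^ 2 * L)) := by gcongr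
      _ = M * N := by rw [hM]; ring
  have hgsum : ∑ i, g i ≤ γ * N := by
    calc ∑ i, g i = ∑ a ∈ G, ∑ j, A a j ^ 2 := Finset.sum_comm
      _ ≤ 2 * P⁻¹ * F := hcon.le
      _ ≤ 2 * P⁻¹ * (N * (D ^ 2 * L)) := by gcongr
      _ = γ * N := by rw [hγ]; ring
  set v : ι → ℝ := fun i => 1 + b i / M + g i / γ with hv
  have hv1 : ∀ i, 1 ≤ v i := fun i => by
    have h1 : 0 ≤ b i / M := div_nonneg (hb0 i) hM0.le
    have h2 : 0 ≤ g i / γ := div_nonneg (hg0 i) hγ0.le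
    simp only [hv]; linarith
  have hv0 : ∀ i, 0 < v i := fun i => one_pos.trans_le (hv1 i)
  have hvsum : ∑ i, v i ≤ 3 * N := by
    rw [hv, Finset.sum_add_distrib, Finset.sum_add_distrib, ← Finset.sum_div, ← Finset.sum_div]
    have h1 : (∑ i, b i) / M ≤ N := by rw [div_le_iff₀ hM0]; linarith
    have h2 : (∑ i, g i) / γ ≤ N := by rw [div_le_iff₀ hγ0]; linarith
    have h3 : ∑ _i : ι, (1 : ℝ) = N := by simp [hN]
    linarith
  obtain ⟨lam, hlam, hcard, hT⟩ := exists_spectrum_sinc_inequality A G (w := fun i => (v i)⁻¹)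
    (N := 3 * N) (M := M) (γ := γ) (one_pos.trans_le hk) hL.le hM0.le hγ0.le
    (fun x hx => (hA x hx).1) (fun i => inv_pos.mpr (hv0 i))
    (fun i => inv_le_one_of_one_le₀ (hv1 i))
    (fun i => by
      rw [inv_mul_le_iff₀ (hv0 i)]
      have h1 : b i / M ≤ v i := by
        have h2 : 0 ≤ g i / γ := div_nonneg (hg0 i) hγ0.le
        simp only [hv]; linarith
      exact (div_le_iff₀ hM0).mp h1)
    (fun i => by
      rw [inv_mul_le_iff₀ (hv0 i)]
      have h1 : g i / γ ≤ v i := by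
        have h2 : 0 ≤ b i / M := div_nonneg (hb0 i) hM0.le
        simp only [hv]; linarith
      exact (div_le_iff₀ hγ0).mp h1)
    (by simpa only [inv_inv] using hvsum)
  set Z : ℝ := ((#{l | lam l = 0} : ℕ) : ℝ) with hZ
  have hZN : β * N ≤ Z := by
    have : N ≤ A.rank + Z := by rw [hN, hZ]; exact_mod_cast hcard
    linarith
  set Λ := Real.log P with hΛ
  have hΛ0 : 0 < Λ := Real.log_pos (by linarith)
  set y := Real.exp (Λ / 8) with hy
  have hy8 : y ^ 8 = P := by
    rw [hy, ← Real.exp_nat_mul]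
    convert Real.exp_log hP0 using 2
    push_cast; ring
  have hnum : 36 * D ^ 2 * y ≤ β ^ 2 * P := by
    rw [← hy8]
    exact error_le_of_pow_le (Real.exp_pos _) hD hβ (by rwa [hy8]) (by rwa [hy8])
  have hcoef : L / k + γ ≤ 3 * P⁻¹ * (D ^ 2 * L) := by
    have h1 : k⁻¹ ≤ P⁻¹ := by
      refine inv_anti₀ hP0 (hPk.trans (div_le_self (by linarith) (one_le_pow₀ hD)))
    have h2 : L / k ≤ P⁻¹ * L := by rw [div_eq_inv_mul]; gcongr
    have h3 : P⁻¹ * L ≤ P⁻¹ * (D ^ 2 * L) := by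
      gcongr
      exact le_mul_of_one_le_left hL.le (one_le_pow₀ hD)
    rw [hγ]; linarith
  set T₀ := Λ / (96 * √M) with hT₀
  have hsM : 0 < √M := Real.sqrt_pos.mpr hM0
  have hmain := card_zero_le_of_sinc_sum lam hlam (κ := L / (12 * N)) (T₀ := T₀) (by positivity)
    (fun T hT0 hTT => by
      set S := ∑ l, Real.sinc (T * √(lam l)) ^ 12 with hS
      have hSZ : β * N ≤ S := by
        refine hZN.trans ?_
        calc Z = ∑ l with lam l = 0, Real.sinc (T * √(lam l)) ^ 12 := by
              rw [hZ, Finset.card_eq_sum_ones, Nat.cast_sum]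
              refine Finset.sum_congr rfl fun l hl => ?_
              simp [(Finset.mem_filter.mp hl).2]
          _ ≤ S := Finset.sum_le_sum_of_subset_of_nonneg (Finset.subset_univ _)
              fun l _ _ => by positivity
      have hE : (Real.exp (T * √M) ^ 6) ^ 2 ≤ y := by
        rw [← pow_mul, ← Real.exp_nat_mul, hy, Real.exp_le_exp]
        rw [hT₀, le_div_iff₀ (by positivity)] at hTT
        push_cast
        linarith
      have h1 := hT T hT0.le
      have h2 : (L / k + γ) * (3 * N) * (Real.exp (T * √M) ^ 6) ^ 2 ≤ L * S ^ 2 / (4 * N) := by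
        calc _ ≤ 3 * P⁻¹ * (D ^ 2 * L) * (3 * N) * y := by gcongr
          _ = (36 * D ^ 2 * y) * (P⁻¹ * L * N / 4) := by ring
          _ ≤ (β ^ 2 * P) * (P⁻¹ * L * N / 4) := by gcongr
          _ = L * (β * N) ^ 2 / (4 * N) := by field_simp
          _ ≤ L * S ^ 2 / (4 * N) := by gcongr
      set W := ∑ l, lam l * Real.sinc (T * √(lam l)) ^ 12 with hW
      have h3 : L * S ^ 2 ≤ 3 * N * (W + L * S ^ 2 / (4 * N)) :=
        h1.trans (by gcongr)
      have h4 : 3 * N * (W + L * S ^ 2 / (4 * N)) = 3 * N * W + 3 / 4 * (L * S ^ 2) := by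
        field_simp
      rw [div_mul_eq_mul_div, div_le_iff₀ (by positivity)]
      linarith)
    (by positivity)
  have hfin := le_mul_of_card_bound hN0 hL (by linarith) hD hZN hmain
  have hD3 : (1 : ℝ) ≤ D ^ 3 := one_le_pow₀ hD
  set u := √β * Λ with hu
  have hu0 : 0 < u := mul_pos (Real.sqrt_pos.mpr hβ) hΛ0
  have hu2 : Λ ^ 2 * β = u ^ 2 := by rw [hu, mul_pow, Real.sq_sqrt hβ.le]; ring
  have hbig : 10 ^ 6 < u := by
    rw [hs, lt_div_iff₀ (by positivity)] at hs1
    linarith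
  have hsD : s * D ^ 2 ≤ u / 10 ^ 6 := by
    have : s * D ^ 2 = u / 10 ^ 6 / D := by rw [hs]; field_simp
    rw [this]
    exact div_le_self (by positivity) hD
  rw [hu2, mul_assoc] at hfin
  nlinarith

/-- **Theorem (ℓ₂-ARIP version).** There is a universal constant `c > 0` such that the following
holds. Let `A ∈ ℝ^{m×n}` have rank `αn` with `0 < α < 1`, and suppose `A` is `(k, D)`-ℓ₂-ARIP
with `k ≥ 1`, `D ≥ 1`. If `η > 0` satisfies `64·D⁸/(1-α)⁴ ≤ n^η ≤ k/D²`, then some submatrix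
`T` of `t ≤ m` rows of `A` satisfies: (1) `‖T‖_F²/‖A‖_F² ≥ n^{-η}`; (2) `t ≥ k/(D²n^η)`; and
(3) every row `x` of `T` has `Δ_{1,2}(x) ≤ c·(D³n/(η√(1-α)·log n))^{1/2}`. -/
theorem ell2_arip_not_sparse :
    ∃ c > (0 : ℝ),
      ∀ (m n : ℕ), 0 < m → 0 < n →
        ∀ (A : Matrix (Fin m) (Fin n) ℝ) (α k D η : ℝ),
          0 < α → α < 1 → (A.rank : ℝ) = α * n →
          1 ≤ k → 1 ≤ D → IsARIP A k D →
          0 < η →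
          64 * D ^ 8 / (1 - α) ^ 4 ≤ (n : ℝ) ^ η →
          (n : ℝ) ^ η ≤ k / D ^ 2 →
          ∃ (t : ℕ) (f : Fin t → Fin m), t ≤ m ∧ Function.Injective f ∧
            frobNorm (Matrix.of fun (i : Fin t) (j : Fin n) => A (f i) j) ^ 2
                / frobNorm A ^ 2 ≥ (n : ℝ) ^ (-η) ∧
            (t : ℝ) ≥ k / (D ^ 2 * (n : ℝ) ^ η) ∧
            ∀ i : Fin t, distortion 1 2 (fun j : Fin n => A (f i) j) ≤
              c * (D ^ 3 * n / (η * Real.sqrt (1 - α) * Real.log n)) ^ ((1 : ℝ) / 2) := by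
  refine ⟨1000, by norm_num, ?_⟩
  intro m n _ hn A α k D η _ hα1 hrank hk hD hARIP hη h1 h2
  have hk0 : 0 < k := by linarith
  have hD0 : 0 < D := by linarith
  obtain ⟨L, hL, hA⟩ := hARIP.exists_sq_bounds hk0
  have : Nonempty (Fin n) := ⟨⟨0, hn⟩⟩
  have hn0 : (0 : ℝ) < n := by exact_mod_cast hn
  have hβ : 0 < 1 - α := by linarith
  have hrn : A.rank < Fintype.card (Fin n) := by
    rw [Fintype.card_fin]
    have : (A.rank : ℝ) < n := by rw [hrank]; nlinarith
    exact_mod_cast this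
  have hkn : k < n := by
    simpa using lt_card_of_rank_lt hL (fun x hx => (hA x hx).1) hrn
  rw [Real.rpow_neg hn0.le]
  have hlogP : Real.log ((n : ℝ) ^ η) = η * Real.log n := Real.log_rpow hn0 η
  set P := (n : ℝ) ^ η
  have hP0 : 0 < P := Real.rpow_pos_of_pos hn0 η
  have hn1 : (1 : ℝ) < n := by linarith
  have hlog : 0 < Real.log n := Real.log_pos hn1
  set s := √(1 - α) * Real.log P / (10 ^ 6 * D ^ 3) with hs
  have hs0 : 0 < s := by
    rw [hs, hlogP]
    have := Real.sqrt_pos.mpr hβ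
    positivity
  classical
  set G : Finset (Fin m) :=
    Finset.univ.filter fun a => s * ∑ j, A a j ^ 2 ≤ (∑ j, |A a j|) ^ 2 with hG
  have hmem : ∀ a, a ∈ G ↔ s * ∑ j, A a j ^ 2 ≤ (∑ j, |A a j|) ^ 2 := fun a => by simp [hG]
  have hdense := sum_sq_dense_rows_ge hk hD hL hA hβ (by linarith)
    (by rw [Fintype.card_fin, hrank]; linarith) h1 h2 G hmem
  have hF : n * L ≤ ∑ a, ∑ j, A a j ^ 2 := by
    rw [Finset.sum_comm]
    calc n * L = ∑ _j : Fin n, L := by simp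
      _ ≤ _ := Finset.sum_le_sum fun j _ => (col_sum_sq_bounds hk hA j).1
  set F := ∑ a, ∑ j, A a j ^ 2
  have hF0 : 0 < F := (mul_pos hn0 hL).trans_le hF
  refine ⟨#G, fun i => (G.equivFin.symm i : Fin m), by simpa using G.card_le_univ,
    Subtype.val_injective.comp G.equivFin.symm.injective, ?_, ?_, fun i => ?_⟩
  · have hsum : ∑ i : Fin #G, ∑ j, A (G.equivFin.symm i) j ^ 2 = ∑ a ∈ G, ∑ j, A a j ^ 2 :=
      (Equiv.sum_comp G.equivFin.symm fun a : G => ∑ j, A a j ^ 2).trans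
        (Finset.sum_coe_sort G fun a => ∑ j, A a j ^ 2)
    rw [frobNorm_sq, frobNorm_sq, ge_iff_le, le_div_iff₀ hF0]
    simp only [Matrix.of_apply]
    rw [hsum]
    refine le_trans ?_ hdense
    nlinarith [mul_pos (inv_pos.mpr hP0) hF0]
  · have hrow : k * ∑ a ∈ G, ∑ j, A a j ^ 2 ≤ #G * (2 * (n * (D ^ 2 * L))) := by
      rw [Finset.mul_sum, ← nsmul_eq_mul]
      exact Finset.sum_le_card_nsmul _ _ _ fun a _ =>
        row_sum_sq_le hk hkn.le (fun x hx => (hA x hx).2) (by positivity) a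
    rw [ge_iff_le, div_le_iff₀ (by positivity)]
    have h3 : k * (2 * P⁻¹ * (n * L)) ≤ #G * (2 * (n * (D ^ 2 * L))) := by
      refine le_trans ?_ hrow
      gcongr
      refine le_trans ?_ hdense
      gcongr
    refine le_of_mul_le_mul_right ?_ (by positivity : 0 < 2 * P⁻¹ * (n * L))
    refine h3.trans_eq ?_
    field_simp
  · refine (distortion_le_of_le_sq_sum hs0 ((hmem _).mp (G.equivFin.symm i).2)).trans_eq ?_
    have h3 : (Fintype.card (Fin n) : ℝ) / s =
        1000 ^ 2 * (D ^ 3 * n / (η * √(1 - α) * Real.log n)) := by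
      have := Real.sqrt_pos.mpr hβ
      rw [hs, hlogP, Fintype.card_fin]
      field_simp
      norm_num
    rw [h3, Real.sqrt_mul (by norm_num), Real.sqrt_sq (by norm_num), Real.sqrt_eq_rpow]
end

section
/- Let m, n be positive integers and let A ∈ ℝ^{m×n} be a matrix of rank αn for some 0 < α < 1. Suppose A is (k,D)-ℓ₂-ARIP for some k ≥ 1 and D ≥ 1/√(1−α) such that k(1−α) ≥ 2. Then there is a universal constant c > 0 such that (Σ_{i=1}^m ‖A_{i*}‖₁²) / ‖A‖_F² ≥ c·√(1−α)·log(k(1−α)) / D³, where A_{i*} denotes the i-th row of A. -/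
open Finset

open Matrix Polynomial

theorem norm_aeval_chebyshev_T_le {R : Type*} [NormedRing R] [NormedAlgebra ℝ R]
    (h1 : ‖(1 : R)‖ ≤ 1) {M : R} (hM : ‖M‖ ≤ 5) (d : ℕ) :
    ‖aeval M (Chebyshev.T ℝ d)‖ ≤ 11 ^ d := by
  induction d using Nat.twoStepInduction with
  | zero => simpa using h1
  | one => simpa using hM.trans (by norm_num)
  | more d ih₀ ih₁ =>
    push_cast at ih₁ ⊢
    rw [Chebyshev.T_add_two]
    have h2 : aeval M (2 * X * Chebyshev.T ℝ ((d : ℤ) + 1) - Chebyshev.T ℝ d) =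
        (2 : ℝ) • (M * aeval M (Chebyshev.T ℝ ((d : ℤ) + 1))) - aeval M (Chebyshev.T ℝ d) := by
      simp [two_smul, two_mul, add_mul]
    rw [h2]
    have h3 := norm_mul_le M (aeval M (Chebyshev.T ℝ ((d : ℤ) + 1)))
    have h4 : ‖M‖ * ‖aeval M (Chebyshev.T ℝ ((d : ℤ) + 1))‖ ≤ 5 * 11 ^ (d + 1) := by gcongr
    calc _ ≤ ‖(2 : ℝ) • (M * aeval M (Chebyshev.T ℝ ((d : ℤ) + 1)))‖ +
          ‖aeval M (Chebyshev.T ℝ d)‖ := norm_sub_le _ _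
      _ ≤ 2 * (5 * 11 ^ (d + 1)) + 11 ^ d := by
          gcongr
          rw [norm_smul]
          norm_num
          linarith
      _ ≤ 11 ^ (d + 2) := by
          rw [pow_succ, pow_add]
          nlinarith [pow_pos (show (0 : ℝ) < 11 by norm_num) d]

theorem Real.sq_half_le_cosh (x : ℝ) : x ^ 2 / 2 ≤ Real.cosh x := by
  have h := Real.self_le_sinh_iff.2 (show 0 ≤ |x| / 2 by positivity)
  have h' : (|x| / 2) ^ 2 ≤ Real.sinh (|x| / 2) ^ 2 := by gcongr
  rw [← Real.cosh_abs, ← mul_div_cancel₀ |x| (two_ne_zero (α := ℝ)),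
    Real.cosh_two_mul, Real.cosh_sq]
  rw [div_pow, sq_abs] at h'
  linarith

theorem sum_sum_sq_eq_trace {μ κ : Type*} [Fintype μ] [Fintype κ] (Q : Matrix μ κ ℝ) :
    ∑ j, ∑ i, Q i j ^ 2 = (Qᵀ * Q).trace := by
  simp [Matrix.trace, Matrix.mul_apply, pow_two]

namespace Matrix

variable {κ : Type*} [Fintype κ] [DecidableEq κ]

theorem IsHermitian.trace_aeval {G : Matrix κ κ ℝ} (hG : G.IsHermitian) (q : ℝ[X]) :
    (aeval G q).trace = ∑ i, q.eval (hG.eigenvalues i) := by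
  set U : Matrix κ κ ℝ := ↑hG.eigenvectorUnitary
  have hU : star U * U = 1 := Unitary.coe_star_mul_self _
  let φ := (Unitary.conjStarAlgAut ℝ _ hG.eigenvectorUnitary).toAlgEquiv.toAlgHom
  have hφ (D : Matrix κ κ ℝ) : φ D = U * D * star U := rfl
  have h : G = φ (diagonalAlgHom ℝ hG.eigenvalues) := hG.spectral_theorem
  conv_lhs => rw [h]
  rw [aeval_algHom_apply, aeval_algHom_apply, hφ, trace_mul_cycle, hU, one_mul, aeval_pi_apply]
  simp [trace, coe_aeval_eq_eval]

theorem IsSymm.aeval {G : Matrix κ κ ℝ} (hG : G.IsSymm) (q : ℝ[X]) : (aeval G q).IsSymm := by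
  induction q using Polynomial.induction_on' with
  | add p q hp hq => rw [map_add]; exact hp.add hq
  | monomial n a =>
    rw [aeval_monomial, ← Algebra.smul_def]
    exact (hG.pow n).smul a

attribute [local instance] Matrix.linftyOpNormedRing Matrix.linftyOpNormedAlgebra

theorem linfty_opNorm_le_iff {A : Matrix κ κ ℝ} {s : ℝ} (hs : 0 ≤ s) :
    ‖A‖ ≤ s ↔ ∀ i, ∑ j, |A i j| ≤ s := by
  lift s to NNReal using hs
  rw [← coe_nnnorm, NNReal.coe_le_coe, linfty_opNNNorm_def, Finset.sup_le_iff]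
  simp [← NNReal.coe_le_coe]

theorem linfty_opNorm_one_le : ‖(1 : Matrix κ κ ℝ)‖ ≤ 1 := by
  rw [linfty_opNorm_le_iff zero_le_one]
  intro i
  simp [one_apply, apply_ite abs]

theorem IsHermitian.eigenvalues_le_of_sum_abs_le {G : Matrix κ κ ℝ} (hG : G.IsHermitian) {s : ℝ}
    (h : ∀ i, ∑ j, |G i j| ≤ s) (i : κ) : hG.eigenvalues i ≤ s := by
  have hs : 0 ≤ s := (Finset.sum_nonneg fun j _ => abs_nonneg (G i j)).trans (h i)
  have : CompleteSpace (Matrix κ κ ℝ) := FiniteDimensional.complete ℝ _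
  have h1 := spectrum.norm_le_norm_mul_of_mem (hG.eigenvalues_mem_spectrum_real i)
  have h2 := (linfty_opNorm_le_iff hs).2 h
  have h3 : ‖G‖ * ‖(1 : Matrix κ κ ℝ)‖ ≤ s * 1 := by
    gcongr
    exact linfty_opNorm_one_le
  exact (le_abs_self _).trans (h1.trans (by simpa using h3))

theorem sum_abs_aeval_chebyshev_T_le {M : Matrix κ κ ℝ} (hM : ∀ i, ∑ j, |M i j| ≤ 5) (d : ℕ)
    (i : κ) : ∑ j, |aeval M (Chebyshev.T ℝ d) i j| ≤ 11 ^ d :=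
  (linfty_opNorm_le_iff (by positivity)).1 (norm_aeval_chebyshev_T_le linfty_opNorm_one_le
    ((linfty_opNorm_le_iff (by norm_num)).2 hM) d) i

end Matrix

/-- If `‖x‖₂ ≤ ‖B x‖₂` on all vectors with `‖x‖₁ ≤ √k ‖x‖₂`, then the dimension of the kernel of
`B` is controlled by any bound `s` on the absolute row sums of the Gram matrix `Bᵀ B`. -/
theorem corank_mul_cosh_sq_le {μ κ : Type*} [Fintype μ] [Fintype κ] (B : Matrix μ κ ℝ) {k s : ℝ}
    (hk : 0 < k) (hs : 1 ≤ s)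
    (hB : ∀ x : κ → ℝ, (∑ j, |x j|) ^ 2 ≤ k * ∑ j, x j ^ 2 → ∑ j, x j ^ 2 ≤ ∑ i, (B *ᵥ x) i ^ 2)
    (hrow : ∀ j, ∑ l, |(Bᵀ * B) j l| ≤ s) (d : ℕ) :
    ((Fintype.card κ : ℝ) - B.rank) * Real.cosh (d / √s) ^ 2 ≤
      Fintype.card κ * (s + 121 ^ d / k) := by
  classical
  have hs0 : 0 < s := by linarith
  set c := Real.cosh (1 / √s) with hc
  have hc_one : 1 ≤ c := Real.one_le_cosh _
  have hc_le : c ≤ 1 + 2 / s := by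
    have h1 : (1 / √s) ^ 2 / 2 = 1 / (2 * s) := by
      rw [div_pow, Real.sq_sqrt hs0.le]; field_simp
    have h2 := Real.cosh_le_exp_half_sq (1 / √s)
    rw [h1] at h2
    have h3 : 1 / (2 * s) ≤ 1 := by rw [div_le_one (by positivity)]; linarith
    have h4 := Real.abs_exp_sub_one_le (x := 1 / (2 * s)) (by
      rwa [abs_of_pos (by positivity)])
    rw [abs_of_pos (show 0 < 1 / (2 * s) by positivity)] at h4
    have h5 : 2 * (1 / (2 * s)) ≤ 2 / s := by
      rw [show 2 * (1 / (2 * s)) = 1 / s by field_simp]; gcongr; norm_num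
    linarith [le_abs_self (Real.exp (1 / (2 * s)) - 1)]
  set G := Bᵀ * B with hGdef
  have hGs : G.IsSymm := by simp [Matrix.IsSymm, hGdef]
  have hG : G.IsHermitian := by
    rwa [Matrix.IsHermitian, Matrix.conjTranspose_eq_transpose_of_trivial]
  set ℓ : ℝ[X] := C c - C (2 / s) * X with hℓ
  set p : ℝ[X] := (Chebyshev.T ℝ d).comp ℓ with hp
  set P := aeval G p with hPdef
  have hPs : Pᵀ = P := hGs.aeval p
  have hM : ∀ i, ∑ j, |aeval G ℓ i j| ≤ 5 := by
    intro i
    calc ∑ j, |aeval G ℓ i j| ≤ ∑ j, (c * (1 : Matrix κ κ ℝ) i j + 2 / s * |G i j|) := by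
          refine Finset.sum_le_sum fun j _ => ?_
          have h1 : aeval G ℓ i j = c * (1 : Matrix κ κ ℝ) i j - 2 / s * G i j := by
            simp [hℓ, Algebra.algebraMap_eq_smul_one]
          rw [h1]
          refine (abs_sub _ _).trans (add_le_add ?_ ?_)
          · rw [abs_of_nonneg]
            have : (0 : ℝ) ≤ (1 : Matrix κ κ ℝ) i j := by
              rw [Matrix.one_apply]; split_ifs <;> norm_num
            positivity
          · rw [abs_mul, abs_of_pos (by positivity)]
      _ = c + 2 / s * ∑ j, |G i j| := by
          rw [Finset.sum_add_distrib, ← Finset.mul_sum, ← Finset.mul_sum]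
          simp [Matrix.one_apply]
      _ ≤ (1 + 2 / s) + 2 / s * s := by gcongr; exact hrow i
      _ ≤ 5 := by
          have : 2 / s ≤ 2 := div_le_self (by norm_num) hs
          rw [div_mul_cancel₀ _ hs0.ne']; linarith
  have hProw : ∀ j, ∑ i, |P i j| ≤ 11 ^ d := by
    intro j
    have h1 := Matrix.sum_abs_aeval_chebyshev_T_le hM d j
    rw [← aeval_comp, ← hp, ← hPdef] at h1
    have h2 : ∀ i, P i j = P j i := fun i => congrFun₂ hPs j i
    simpa only [h2] using h1
  have hcol : ∀ j, ∑ i, P i j ^ 2 - ∑ i, (B * P) i j ^ 2 ≤ 121 ^ d / k := by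
    intro j
    by_cases h : (∑ i, |P i j|) ^ 2 ≤ k * ∑ i, P i j ^ 2
    · have h1 : ∑ i, P i j ^ 2 ≤ ∑ i, (B * P) i j ^ 2 := hB (fun i => P i j) h
      have : (0 : ℝ) ≤ 121 ^ d / k := by positivity
      linarith
    · push Not at h
      have h1 : (∑ i, |P i j|) ^ 2 ≤ 121 ^ d := by
        calc _ ≤ ((11 : ℝ) ^ d) ^ 2 := by gcongr; exact hProw j
          _ = 121 ^ d := by rw [← pow_mul, mul_comm, pow_mul]; norm_num
      have h2 : ∑ i, P i j ^ 2 ≤ 121 ^ d / k := by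
        rw [le_div_iff₀ hk]; linarith
      have : 0 ≤ ∑ i, (B * P) i j ^ 2 := by positivity
      linarith
  have htr : ∑ j, (∑ i, P i j ^ 2 - ∑ i, (B * P) i j ^ 2) =
      ∑ i, (1 - hG.eigenvalues i) * p.eval (hG.eigenvalues i) ^ 2 := by
    have h1 := hG.trace_aeval ((1 - X) * p ^ 2)
    have h2 : aeval G ((1 - X) * p ^ 2) = Pᵀ * P - (B * P)ᵀ * (B * P) := by
      have h3 : aeval G ((1 - X) * p ^ 2) = aeval G (p * p - p * X * p) := by congr 1; ring
      rw [h3, Matrix.transpose_mul, hPs]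
      simp only [map_sub, map_mul, aeval_X, ← hPdef]
      simp only [hGdef, Matrix.mul_assoc]
    rw [h2] at h1
    simp only [eval_mul, eval_sub, eval_one, eval_X, eval_pow] at h1
    rw [← h1, Finset.sum_sub_distrib]
    rw [sum_sum_sq_eq_trace, sum_sum_sq_eq_trace, Matrix.trace_sub]
  have heval (t : ℝ) : p.eval t = (Chebyshev.T ℝ d).eval (c - 2 / s * t) := by
    simp [hp, hℓ]
  have hterm : ∀ i, (if hG.eigenvalues i = 0 then Real.cosh (d / √s) ^ 2 else 0) - s ≤
      (1 - hG.eigenvalues i) * p.eval (hG.eigenvalues i) ^ 2 := by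
    intro i
    have hle := hG.eigenvalues_le_of_sum_abs_le hrow i
    split_ifs with h0
    · have : p.eval 0 = Real.cosh (d / √s) := by
        rw [heval, mul_zero, sub_zero, hc, Chebyshev.T_real_cosh]
        simp [div_eq_mul_inv]
      rw [h0, this]; linarith
    · by_cases h1 : hG.eigenvalues i ≤ 1
      · have := mul_nonneg (sub_nonneg.2 h1) (sq_nonneg (p.eval (hG.eigenvalues i)))
        linarith
      · push Not at h1
        have h2 : p.eval (hG.eigenvalues i) ^ 2 ≤ 1 := by
          rw [heval, sq_le_one_iff_abs_le_one]
          refine Chebyshev.abs_eval_T_real_le_one d (abs_le.2 ⟨?_, ?_⟩)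
          · have : 2 / s * hG.eigenvalues i ≤ 2 / s * s := by gcongr
            rw [div_mul_cancel₀ _ hs0.ne'] at this
            linarith
          · have : 2 / s * 1 ≤ 2 / s * hG.eigenvalues i := by gcongr
            linarith
        nlinarith [sq_nonneg (p.eval (hG.eigenvalues i))]
  have hcard : (Fintype.card κ : ℝ) - B.rank =
      ((Finset.univ.filter fun i => hG.eigenvalues i = 0).card : ℝ) := by
    rw [← Matrix.rank_transpose_mul_self, hG.rank_eq_card_non_zero_eigs, Fintype.card_subtype,
      sub_eq_iff_eq_add, ← Finset.card_univ]
    exact_mod_cast (Finset.card_filter_add_card_filter_not _).symm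
  have hsum := Finset.sum_le_sum fun i (_ : i ∈ Finset.univ) => hterm i
  have hsum' := Finset.sum_le_sum fun j (_ : j ∈ Finset.univ) => hcol j
  rw [htr] at hsum'
  simp only [Finset.sum_sub_distrib, ← Finset.sum_filter, Finset.sum_const, nsmul_eq_mul,
    ← hcard, Finset.card_univ] at hsum hsum'
  linarith

/-- Columns of large correlation with the others are few, by Markov's inequality, and the bound
`corank_mul_cosh_sq_le` applies to the matrix of the remaining columns. -/
theorem le_sum_sq_sum_abs {m n : ℕ} (hn : 0 < n) (A : Matrix (Fin m) (Fin n) ℝ) {β k : ℝ}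
    (hβ : 0 < β) (hβ1 : β ≤ 1) (hrank : (A.rank : ℝ) = (1 - β) * n) (hk : 1 ≤ k)
    (hkβ : 2 ≤ k * β)
    (hA : ∀ x : Fin n → ℝ, (∑ j, |x j|) ^ 2 ≤ k * ∑ j, x j ^ 2 →
      ∑ j, x j ^ 2 ≤ ∑ i, (A *ᵥ x) i ^ 2) :
    1 / 40 * (β * Real.log (k * β)) * n ≤ ∑ i, (∑ j, |A i j|) ^ 2 := by
  have hk0 : 0 < k := by linarith
  have hn' : (0 : ℝ) < n := by exact_mod_cast hn
  set L := Real.log (k * β) with hL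
  set W := ∑ i, (∑ j, |A i j|) ^ 2 with hW
  have hWn : (n : ℝ) ≤ W := by
    have hcol (j : Fin n) : 1 ≤ ∑ i, A i j ^ 2 := by
      have h := hA (Pi.single j 1)
      simp only [Matrix.mulVec_single_one, Pi.single_apply, apply_ite abs, ite_pow] at h
      simpa using h (by simpa using hk)
    calc (n : ℝ) = ∑ j : Fin n, (1 : ℝ) := by simp
      _ ≤ ∑ j, ∑ i, A i j ^ 2 := Finset.sum_le_sum fun j _ => hcol j
      _ = ∑ i, ∑ j, |A i j| ^ 2 := by rw [Finset.sum_comm]; simp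
      _ ≤ W := Finset.sum_le_sum fun i _ =>
          Finset.sum_sq_le_sq_sum_of_nonneg fun j _ => abs_nonneg _
  by_contra! hlt
  have hβL : 40 < β * L := by
    by_contra! h
    have : 1 / 40 * (β * L) * n ≤ 1 / 40 * 40 * n := by gcongr
    linarith
  have hL40 : 40 < L := by nlinarith
  set s := 2 * W / (β * n) with hs
  have hβn : 0 < β * n := by positivity
  have hs2 : 2 ≤ s := by
    rw [hs, le_div_iff₀ hβn]; nlinarith
  have hsL : s < L / 20 := by
    rw [hs, div_lt_iff₀ hβn]; nlinarith
  have hs0 : 0 < s := by linarith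
  let r : Fin n → ℝ := fun j => ∑ l, ∑ i, |A i j| * |A i l|
  have hr0 (j) : 0 ≤ r j := by positivity
  have hrW : ∑ j, r j = W := by
    simp only [r, hW, pow_two, Finset.sum_mul_sum]
    rw [Finset.sum_comm_cycle]
  let B : Matrix (Fin m) {j // r j ≤ s} ℝ := A.submatrix id Subtype.val
  set N : ℝ := ↑(Fintype.card {j // r j ≤ s}) with hN
  have hNn : N ≤ n := by
    have := Fintype.card_subtype_le fun j : Fin n => r j ≤ s
    rw [Fintype.card_fin] at this
    rw [hN]
    exact_mod_cast this
  have hcompl : n - N ≤ β * n / 2 := by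
    have h1 : (n : ℝ) - N = ((Finset.univ.filter fun j => ¬ r j ≤ s).card : ℝ) := by
      rw [hN, Fintype.card_subtype, sub_eq_iff_eq_add']
      have := Finset.card_filter_add_card_filter_not (s := Finset.univ) (fun j => r j ≤ s)
      rw [Finset.card_univ, Fintype.card_fin] at this
      exact_mod_cast this.symm
    have h2 : ((Finset.univ.filter fun j => ¬ r j ≤ s).card : ℝ) * s ≤ W := by
      rw [← nsmul_eq_mul, ← Finset.sum_const, ← hrW]
      exact (Finset.sum_le_sum fun j hj => (not_le.1 (Finset.mem_filter.1 hj).2).le).trans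
        (Finset.sum_le_sum_of_subset_of_nonneg (Finset.filter_subset _ _) fun j _ _ => hr0 j)
    have h3 : W = β * n / 2 * s := by rw [hs]; field_simp
    rw [h1]
    exact le_of_mul_le_mul_right (h2.trans_eq h3) hs0
  have hrankB : (B.rank : ℝ) ≤ (1 - β) * n := by
    rw [← hrank]
    exact_mod_cast A.rank_submatrix_le id Subtype.val
  have hB : ∀ x : {j // r j ≤ s} → ℝ, (∑ j, |x j|) ^ 2 ≤ k * ∑ j, x j ^ 2 →
      ∑ j, x j ^ 2 ≤ ∑ i, (B *ᵥ x) i ^ 2 := by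
    intro x hx
    let y : Fin n → ℝ := fun j => if h : r j ≤ s then x ⟨j, h⟩ else 0
    have hy (f : Fin n → ℝ → ℝ) (hf : ∀ j, f j 0 = 0) :
        ∑ j, f j (y j) = ∑ j : {j // r j ≤ s}, f j (x j) := by
      have h1 : ∑ j : {j // r j ≤ s}, f j (x j) = ∑ j : {j // r j ≤ s}, f j (y j) :=
        Finset.sum_congr rfl fun j _ => by simp [y, j.2]
      rw [h1, ← Finset.sum_subtype (Finset.univ.filter fun j => r j ≤ s) (by simp)
        (fun j => f j (y j)), Finset.sum_filter_of_ne]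
      intro j _ hj
      by_contra h
      exact hj (by simp [y, h, hf])
    have hmul : A *ᵥ y = B *ᵥ x := by
      ext i
      exact hy (fun j t => A i j * t) (by simp)
    have h := hA y
    rw [hmul, hy (fun _ t => |t|) (by simp), hy (fun _ t => t ^ 2) (by simp)] at h
    exact h hx
  have hrow : ∀ j, ∑ l, |(Bᵀ * B) j l| ≤ s := by
    intro j
    calc ∑ l, |(Bᵀ * B) j l| ≤ ∑ l : {j // r j ≤ s}, ∑ i, |A i j| * |A i l| := by
          refine Finset.sum_le_sum fun l _ => ?_
          rw [Matrix.mul_apply]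
          refine (Finset.abs_sum_le_sum_abs _ _).trans_eq ?_
          simp [B, abs_mul]
      _ = ∑ l ∈ Finset.univ.filter (fun j => r j ≤ s), ∑ i, |A i j| * |A i l| :=
          (Finset.sum_subtype (Finset.univ.filter fun j => r j ≤ s) (by simp)
            (fun l => ∑ i, |A i j| * |A i l|)).symm
      _ ≤ r j := Finset.sum_le_sum_of_subset_of_nonneg (Finset.filter_subset _ _)
          fun l _ _ => by positivity
      _ ≤ s := j.2
  set d := ⌊Real.log k / 5⌋₊ with hd
  have hlogk : L ≤ Real.log k := by
    apply Real.log_le_log (by linarith)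
    nlinarith
  have hdL : L / 10 ≤ d := by
    have := Nat.lt_floor_add_one (Real.log k / 5)
    rw [← hd] at this
    linarith
  have hdk : (121 : ℝ) ^ d / k ≤ 1 := by
    rw [div_le_one hk0]
    have h1 : (121 : ℝ) ≤ Real.exp 5 := by
      have : (2.7 : ℝ) ^ 5 ≤ Real.exp 1 ^ 5 := by
        gcongr; linarith [Real.exp_one_gt_d9]
      rw [← Real.exp_nat_mul] at this
      norm_num at this ⊢
      linarith
    have h2 : (d : ℝ) ≤ Real.log k / 5 := Nat.floor_le (by linarith)
    calc (121 : ℝ) ^ d ≤ Real.exp 5 ^ d := by gcongr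
      _ = Real.exp (d * 5) := by rw [← Real.exp_nat_mul]
      _ ≤ Real.exp (Real.log k) := by gcongr; linarith
      _ = k := Real.exp_log hk0
  have key := corank_mul_cosh_sq_le B hk0 (by linarith) hB hrow d
  have hcosh : (d : ℝ) ^ 2 / (2 * s) ≤ Real.cosh (d / √s) := by
    have h1 := Real.sq_half_le_cosh (d / √s)
    rwa [div_pow, Real.sq_sqrt hs0.le, div_div, mul_comm s] at h1
  have hcorank : β * n / 2 ≤ N - B.rank := by linarith
  have h1 : β * n / 2 * ((d : ℝ) ^ 2 / (2 * s)) ^ 2 ≤ n * (s + s) := by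
    calc β * n / 2 * ((d : ℝ) ^ 2 / (2 * s)) ^ 2
        ≤ (N - B.rank) * Real.cosh (d / √s) ^ 2 := by
          gcongr
          exact (by positivity : 0 ≤ β * n / 2).trans hcorank
      _ ≤ N * (s + 121 ^ d / k) := key
      _ ≤ n * (s + s) := by gcongr; linarith
  have h2 : β * (d : ℝ) ^ 4 ≤ 16 * s ^ 3 := by
    have h3 : β * n / 2 * ((d : ℝ) ^ 2 / (2 * s)) ^ 2 = n * (β * d ^ 4 / (8 * s ^ 2)) := by
      field_simp; ring
    rw [h3] at h1
    have h4 := le_of_mul_le_mul_left h1 hn'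
    rw [div_le_iff₀ (by positivity)] at h4
    linarith
  have h3 : β * (L / 10) ^ 4 ≤ 16 * (L / 20) ^ 3 := by
    calc β * (L / 10) ^ 4 ≤ β * (d : ℝ) ^ 4 := by gcongr
      _ ≤ 16 * s ^ 3 := h2
      _ ≤ 16 * (L / 20) ^ 3 := by gcongr
  have h4 : 0 < L ^ 3 := by positivity
  nlinarith

theorem pNorm_one {ι : Type*} [Fintype ι] (x : ι → ℝ) : pNorm 1 x = ∑ i, |x i| := by
  simp [pNorm]

theorem pNorm_two {ι : Type*} [Fintype ι] (x : ι → ℝ) : pNorm 2 x = √(∑ i, x i ^ 2) := by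
  simp [pNorm, Real.sqrt_eq_rpow]

theorem pNorm_two_sq {ι : Type*} [Fintype ι] (x : ι → ℝ) : pNorm 2 x ^ 2 = ∑ i, x i ^ 2 := by
  rw [pNorm_two, Real.sq_sqrt (by positivity)]

/-- A nonzero vector satisfies the distortion hypothesis of `IsARIP` as soon as
`‖x‖₁ ≤ √k ‖x‖₂`. -/
theorem le_distortion_of_sq_le {ι : Type*} [Fintype ι] {k : ℝ} (hk : 0 < k) {x : ι → ℝ}
    (hx : x ≠ 0) (h : (∑ j, |x j|) ^ 2 ≤ k * ∑ j, x j ^ 2) :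
    ((Fintype.card ι : ℝ) / k) ^ ((1 : ℝ) / 2) ≤ distortion 1 2 x := by
  obtain ⟨j, hj⟩ := Function.ne_iff.1 hx
  have hpos : 0 < ∑ j, |x j| :=
    Finset.sum_pos' (fun _ _ => abs_nonneg _) ⟨j, Finset.mem_univ _, abs_pos.2 hj⟩
  have h1 : ∑ j, |x j| ≤ √k * √(∑ j, x j ^ 2) := by
    rw [← Real.sqrt_mul hk.le]
    exact Real.le_sqrt_of_sq_le h
  rw [distortion, pNorm_one, pNorm_two, le_div_iff₀ hpos,
    show (1 : ℝ) / 1 - 1 / 2 = 1 / 2 by norm_num, ← Real.sqrt_eq_rpow, ← Real.sqrt_eq_rpow,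
    Real.sqrt_div (by positivity)]
  have hk' : 0 < √k := Real.sqrt_pos.2 hk
  rw [div_mul_eq_mul_div, div_le_iff₀ hk']
  nlinarith [Real.sqrt_nonneg (Fintype.card ι : ℝ)]

theorem IsARIP.exists_bounds {ι κ : Type*} [Fintype ι] [Fintype κ] {A : Matrix ι κ ℝ} {k D : ℝ}
    (hk : 0 < k) (h : IsARIP A k D) :
    ∃ K > 0, ∀ x : κ → ℝ, (∑ j, |x j|) ^ 2 ≤ k * ∑ j, x j ^ 2 →
      K ^ 2 * ∑ j, x j ^ 2 ≤ ∑ i, (A *ᵥ x) i ^ 2 ∧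
        ∑ i, (A *ᵥ x) i ^ 2 ≤ D ^ 2 * K ^ 2 * ∑ j, x j ^ 2 := by
  obtain ⟨K, hK, h⟩ := h
  refine ⟨K, hK, fun x hx => ?_⟩
  rcases eq_or_ne x 0 with rfl | hx0
  · simp
  obtain ⟨h1, h2⟩ := h x (le_distortion_of_sq_le hk hx0 hx)
  have h0 : 0 ≤ pNorm 2 x := by rw [pNorm_two]; positivity
  have h0' : 0 ≤ pNorm 2 (A *ᵥ x) := by rw [pNorm_two]; positivity
  rw [← pNorm_two_sq, ← pNorm_two_sq, ← mul_pow, ← mul_pow, ← mul_pow]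
  exact ⟨by gcongr, by gcongr⟩

/-- There is a universal constant `c > 0` such that: if `A ∈ ℝ^{m×n}` has rank `αn` with
`0 < α < 1` and is `(k, D)`-ℓ₂-ARIP with `k ≥ 1`, `D ≥ 1/√(1-α)` and `k(1-α) ≥ 2`, then
`(∑ᵢ ‖A_{i*}‖₁²)/‖A‖_F² ≥ c·√(1-α)·log(k(1-α))/D³`. -/
theorem arip_row_l1_lower_bound :
    ∃ c > (0 : ℝ),
      ∀ (m n : ℕ), 0 < m → 0 < n →
        ∀ (A : Matrix (Fin m) (Fin n) ℝ) (α k D : ℝ),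
          0 < α → α < 1 → (A.rank : ℝ) = α * n →
          1 ≤ k → 1 / Real.sqrt (1 - α) ≤ D → 2 ≤ k * (1 - α) →
          IsARIP A k D →
          (∑ i : Fin m, pNorm 1 (A i) ^ 2) / frobNorm A ^ 2 ≥
            c * Real.sqrt (1 - α) * Real.log (k * (1 - α)) / D ^ 3 := by
  refine ⟨1 / 40, by norm_num, fun m n _ hn A α k D hα0 hα hrank hk hD hkα hA => ?_⟩
  have hk0 : 0 < k := by linarith
  have hn' : (0 : ℝ) < n := by exact_mod_cast hn
  obtain ⟨K, hK, h⟩ := hA.exists_bounds hk0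
  have hβ : 0 < 1 - α := by linarith
  have hsq : 0 < √(1 - α) := Real.sqrt_pos.2 hβ
  have hD0 : 0 < D := lt_of_lt_of_le (by positivity) hD
  have hDβ : 1 ≤ √(1 - α) * D := by rwa [div_le_iff₀' hsq] at hD
  have hL : 0 ≤ Real.log (k * (1 - α)) := Real.log_nonneg (by linarith)
  have hF : frobNorm A ^ 2 = ∑ j, ∑ i, A i j ^ 2 := by
    rw [frobNorm, Real.sq_sqrt (by positivity), Finset.sum_comm]
  have hcol (j : Fin n) : K ^ 2 ≤ ∑ i, A i j ^ 2 ∧ ∑ i, A i j ^ 2 ≤ D ^ 2 * K ^ 2 := by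
    have h := h (Pi.single j 1)
    simp only [Matrix.mulVec_single_one, Pi.single_apply, apply_ite abs, ite_pow] at h
    simpa using h (by simpa using hk)
  have hF_le : frobNorm A ^ 2 ≤ n * (D ^ 2 * K ^ 2) := by
    rw [hF]
    simpa using Finset.sum_le_sum fun j (_ : j ∈ Finset.univ) => (hcol j).2
  have hF_pos : 0 < frobNorm A ^ 2 := by
    have : n * K ^ 2 ≤ frobNorm A ^ 2 := by
      rw [hF]
      simpa using Finset.sum_le_sum fun j (_ : j ∈ Finset.univ) => (hcol j).1
    exact lt_of_lt_of_le (by positivity) this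
  have hmain := le_sum_sq_sum_abs hn (K⁻¹ • A) hβ (by linarith)
    (by rw [Matrix.rank_smul_of_mem_nonZeroDivisors A
          (mem_nonZeroDivisors_of_ne_zero (inv_ne_zero hK.ne')), hrank]; ring) hk hkα
    (fun x hx => by
      have := (h x hx).1
      simp only [Matrix.smul_mulVec, Pi.smul_apply, smul_eq_mul, mul_pow, ← Finset.mul_sum]
      rwa [inv_pow, inv_mul_eq_div, le_div_iff₀' (by positivity)])
  simp only [Matrix.smul_apply, smul_eq_mul, abs_mul, ← Finset.mul_sum, mul_pow, sq_abs] at hmain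
  rw [inv_pow, inv_mul_eq_div, le_div_iff₀' (by positivity)] at hmain
  simp only [pNorm_one]
  rw [ge_iff_le, div_le_div_iff₀ (by positivity) hF_pos]
  set β := 1 - α
  set L := Real.log (k * β)
  calc 1 / 40 * √β * L * frobNorm A ^ 2
      ≤ 1 / 40 * √β * L * (n * (D ^ 2 * K ^ 2)) * 1 := by rw [mul_one]; gcongr
    _ ≤ 1 / 40 * √β * L * (n * (D ^ 2 * K ^ 2)) * (√β * D) := by gcongr
    _ = K ^ 2 * (1 / 40 * (√β ^ 2 * L) * n) * D ^ 3 := by ring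
    _ = K ^ 2 * (1 / 40 * (β * L) * n) * D ^ 3 := by rw [Real.sq_sqrt hβ.le]
    _ ≤ (∑ i, (∑ j, |A i j|) ^ 2) * D ^ 3 := by gcongr
end

section
/- Fix 1 ≤ q < p, integers 1 ≤ k ≤ n, and a nonzero vector x ∈ ℝⁿ. Then x is (k, (n/k)^{1/q} / Δ_{q,p}(x))-ℓ_p-compressible. -/
open Finset

/-- A nonzero vector `x ∈ ℝⁿ` is `(k, ε)`-ℓ_p-compressible if there is a `k`-sparse `y` with
`‖x - y‖_p ≤ ε‖x‖_p`. -/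
def IsCompressible (p : ℝ) {ι : Type*} [Fintype ι] (k : ℕ) (ε : ℝ) (x : ι → ℝ) : Prop :=
  ∃ y : ι → ℝ, (Finset.univ.filter (fun i => y i ≠ 0)).card ≤ k ∧
    pNorm p (fun i => x i - y i) ≤ ε * pNorm p x

theorem exists_card_eq_forall_notMem_le {ι : Type*} [Fintype ι] [DecidableEq ι] (f : ι → ℝ)
    {k : ℕ} (hk : k ≤ Fintype.card ι) :
    ∃ T : Finset ι, T.card = k ∧ ∀ i ∉ T, ∀ j ∈ T, f i ≤ f j := by
  induction k with
  | zero => exact ⟨∅, by simp, by simp⟩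
  | succ k ih =>
    obtain ⟨T, hT, h⟩ := ih (by omega)
    have hne : (Tᶜ).Nonempty := by
      rw [← Finset.card_pos, Finset.card_compl]
      omega
    obtain ⟨m, hm, hmax⟩ := Finset.exists_max_image Tᶜ f hne
    rw [Finset.mem_compl] at hm
    refine ⟨insert m T, by rw [Finset.card_insert_of_notMem hm, hT], fun i hi j hj => ?_⟩
    rw [Finset.mem_insert, not_or] at hi
    rcases Finset.mem_insert.1 hj with rfl | hj
    · exact hmax i (Finset.mem_compl.2 hi.2)
    · exact h i hi.2 j hj

theorem pNorm_pos {ι : Type*} [Fintype ι] (p : ℝ) {x : ι → ℝ} (hx : x ≠ 0) : 0 < pNorm p x := by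
  obtain ⟨i, hi⟩ := Function.ne_iff.1 hx
  exact Real.rpow_pos_of_pos (Finset.sum_pos' (fun j _ => by positivity)
    ⟨i, Finset.mem_univ i, Real.rpow_pos_of_pos (abs_pos.2 hi) p⟩) _

/-- The `ℓ_p` error of removing the `k` largest entries of `x` is at most
`k^(1/p) * (‖x‖_q^q / k)^(1/q)`. -/
theorem exists_sparse_pNorm_sub_le {ι : Type*} [Fintype ι] {q p : ℝ} (hq : 0 < q) (hqp : q < p)
    {k : ℕ} (hk : 1 ≤ k) (hkn : k ≤ Fintype.card ι) (x : ι → ℝ) :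
    ∃ y : ι → ℝ, (Finset.univ.filter (fun i => y i ≠ 0)).card ≤ k ∧
      pNorm p (fun i => x i - y i) ≤
        (k : ℝ) ^ (1 / p) * ((∑ i, |x i| ^ q) / k) ^ (1 / q) := by
  classical
  obtain ⟨T, hT, h⟩ := exists_card_eq_forall_notMem_le (fun i => |x i|) hkn
  have hp : 0 < p := hq.trans hqp
  have hk0 : (0 : ℝ) < k := by exact_mod_cast hk
  set S := ∑ i, |x i| ^ q with hS
  have hS0 : 0 ≤ S := Finset.sum_nonneg fun i _ => by positivity
  have hA0 : 0 ≤ S / k := by positivity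
  refine ⟨fun i => if i ∈ T then x i else 0, ?_, ?_⟩
  · rw [← hT]
    refine Finset.card_le_card fun i hi => ?_
    by_contra hiT
    simp [hiT] at hi
  have hterm : ∀ i, |x i - if i ∈ T then x i else 0| ^ p ≤ (S / k) ^ (p / q - 1) * |x i| ^ q := by
    intro i
    by_cases hi : i ∈ T
    · simp only [hi, if_true, sub_self, abs_zero, Real.zero_rpow hp.ne']
      positivity
    have hki : |x i| ^ q ≤ S / k := by
      rw [le_div_iff₀ hk0, mul_comm, ← hT, ← nsmul_eq_mul]
      exact (Finset.card_nsmul_le_sum T _ _ fun j hj =>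
        Real.rpow_le_rpow (abs_nonneg _) (h i hi j hj) hq.le).trans
        (Finset.sum_le_sum_of_subset_of_nonneg (Finset.subset_univ T) fun j _ _ => by positivity)
    have hpq : 0 ≤ p / q - 1 := by
      rw [sub_nonneg, one_le_div hq]
      exact hqp.le
    have hsplit : |x i| ^ p = (|x i| ^ q) ^ (p / q - 1) * |x i| ^ q := by
      rw [← Real.rpow_mul (abs_nonneg _),
        ← Real.rpow_add_of_nonneg (abs_nonneg _) (by positivity) hq.le]
      congr 1
      field_simp
      ring
    simp only [hi, if_false, sub_zero]
    rw [hsplit]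
    gcongr
  have hsum : ∑ i, |x i - if i ∈ T then x i else 0| ^ p ≤ k * (S / k) ^ (p / q) := by
    refine (Finset.sum_le_sum fun i _ => hterm i).trans_eq ?_
    have hSk : S = k * (S / k) := by field_simp
    rw [← Finset.mul_sum, ← hS]
    have hpow : (S / k) ^ (p / q) = (S / k) ^ (p / q - 1) * (S / k) := by
      conv_rhs => rw [← Real.rpow_add_one' hA0 (by simp; exact ⟨hp.ne', hq.ne'⟩)]
      rw [sub_add_cancel]
    rw [hpow]
    field_simp
  calc pNorm p (fun i => x i - if i ∈ T then x i else 0)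
      ≤ (k * (S / k) ^ (p / q)) ^ (1 / p) :=
        Real.rpow_le_rpow (Finset.sum_nonneg fun i _ => by positivity) hsum (by positivity)
    _ = (k : ℝ) ^ (1 / p) * (S / k) ^ (1 / q) := by
        rw [Real.mul_rpow hk0.le (by positivity), ← Real.rpow_mul hA0]
        congr 2
        field_simp

/-- If `1 ≤ q < p`, `1 ≤ k ≤ n` and `x ∈ ℝⁿ` is nonzero, then `x` is
`(k, (n/k)^{1/q}/Δ_{q,p}(x))`-ℓ_p-compressible. -/
theorem distorted_imp_compressible {n : ℕ} (q p : ℝ) (hq : 1 ≤ q) (hqp : q < p)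
    (k : ℕ) (hk : 1 ≤ k) (hkn : k ≤ n) (x : Fin n → ℝ) (hx : x ≠ 0) :
    IsCompressible p k (((n : ℝ) / k) ^ (1 / q) / distortion q p x) x := by
  have hq0 : 0 < q := by linarith
  have hp0 : 0 < p := hq0.trans hqp
  have hk0 : (0 : ℝ) < k := by exact_mod_cast hk
  have hn0 : (0 : ℝ) < n := by exact_mod_cast hk.trans hkn
  obtain ⟨y, hy, hxy⟩ := exists_sparse_pNorm_sub_le hq0 hqp hk (by simpa using hkn) x
  refine ⟨y, hy, hxy.trans ?_⟩
  have hS0 : 0 ≤ ∑ i, |x i| ^ q := Finset.sum_nonneg fun i _ => by positivity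
  have hε : ((n : ℝ) / k) ^ (1 / q) / distortion q p x * pNorm p x =
      (n : ℝ) ^ (1 / p) * ((∑ i, |x i| ^ q) / k) ^ (1 / q) := by
    have hxp := pNorm_pos p hx
    have hxq := pNorm_pos q hx
    rw [distortion, Fintype.card_fin, Real.div_rpow hn0.le hk0.le, Real.div_rpow hS0 hk0.le,
      Real.rpow_sub hn0]
    change _ = _ * (pNorm q x / _)
    field_simp
  rw [hε]
  gcongr
end
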